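/- Fix C ≥ 6 and ε > 0. Assume x^ε ≤ Q ≤ x. Then, for all sufficiently large x (depending on C and ε), the number S(Q) of prime powers p^N in the interval (Q, 2Q] whose base prime satisfies p ≤ (log x)^C obeys S(Q) ≫ (log x)^{C−1}, with an implied constant depending only on C and ε. -/

import Mathlib

noncomputable section

open Finset ComplexConjugate

namespace PrimePowers

/-- The additive character `t ↦ exp (2πit)`. -/
def e (t : ℝ) : ℂ := Complex.exp ((2 * Real.pi * t : ℝ) * Complex.I)

lemma norm_e (t : ℝ) : ‖e t‖ = 1 := Complex.norm_exp_ofReal_mul_I _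

lemma e_add (s t : ℝ) : e (s + t) = e s * e t := by
  unfold e
  rw [← Complex.exp_add]
  congr 1
  push_cast
  ring

lemma conj_e (t : ℝ) : conj (e t) = e (-t) := by
  unfold e
  rw [← Complex.exp_conj, map_mul, Complex.conj_I, Complex.conj_ofReal]
  congr 1
  push_cast
  ring

lemma e_sub (s t : ℝ) : e (s - t) = e s * conj (e t) := by
  rw [conj_e, ← e_add, sub_eq_add_neg]

lemma e_zero : e 0 = 1 := by simp [e]

lemma re_e (t : ℝ) : (e t).re = Real.cos (2 * Real.pi * t) := by
  unfold e
  rw [Complex.exp_ofReal_mul_I_re]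

/-- Abel summation for a monotone nonnegative weight, in terms of the tails of the series. -/
lemma norm_sum_weight_le {a b : ℕ} (hab : a ≤ b) {w : ℕ → ℝ} {z : ℕ → ℂ} {W B : ℝ} (hB : 0 ≤ B)
    (hmono : ∀ i, a ≤ i → i + 1 < b → w i ≤ w (i + 1)) (h0 : ∀ i, a ≤ i → i < b → 0 ≤ w i)
    (hW : ∀ i, a ≤ i → i < b → w i ≤ W) (h0W : 0 ≤ W)
    (htail : ∀ j, a ≤ j → j ≤ b → ‖∑ i ∈ Ico j b, z i‖ ≤ B) :
    ‖∑ i ∈ Ico a b, (w i : ℂ) * z i‖ ≤ W * B := by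
  rcases hab.eq_or_lt with rfl | hlt
  · simpa using mul_nonneg h0W hB
  have key : ∀ k j, j + k + 1 = b → a ≤ j →
      ‖∑ i ∈ Ico j b, (w i : ℂ) * z i - w j * ∑ i ∈ Ico j b, z i‖ ≤ (W - w j) * B := by
    intro k
    induction k with
    | zero =>
      intro j hj haj
      have : Ico j b = {j} := by ext i; simp; omega
      rw [this]
      simpa using mul_nonneg (sub_nonneg.2 (hW j haj (by omega))) hB
    | succ k ih =>
      intro j hj haj
      have h1 := ih (j + 1) (by omega) (by omega)
      have h2 := htail (j + 1) (by omega) (by omega)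
      have h3 := hmono j haj (by omega)
      rw [sum_eq_sum_Ico_succ_bot (by omega : j < b), sum_eq_sum_Ico_succ_bot (by omega : j < b)]
      calc _ = ‖(∑ i ∈ Ico (j + 1) b, (w i : ℂ) * z i - w (j + 1) * ∑ i ∈ Ico (j + 1) b, z i)
            + ((w (j + 1) - w j : ℝ) : ℂ) * ∑ i ∈ Ico (j + 1) b, z i‖ := by
              congr 1; push_cast; ring
        _ ≤ (W - w (j + 1)) * B + (w (j + 1) - w j) * B := by
              refine (norm_add_le _ _).trans (add_le_add h1 ?_)
              rw [norm_mul, Complex.norm_real, Real.norm_of_nonneg (sub_nonneg.2 h3)]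
              exact mul_le_mul_of_nonneg_left h2 (sub_nonneg.2 h3)
        _ = _ := by ring
  have h1 := key (b - a - 1) a (by omega) le_rfl
  have h2 := htail a le_rfl hab
  have h3 := h0 a le_rfl hlt
  calc _ = ‖(∑ i ∈ Ico a b, (w i : ℂ) * z i - w a * ∑ i ∈ Ico a b, z i)
            + (w a : ℂ) * ∑ i ∈ Ico a b, z i‖ := by congr 1; ring
    _ ≤ (W - w a) * B + w a * B := by
      refine (norm_add_le _ _).trans (add_le_add h1 ?_)
      rw [norm_mul, Complex.norm_real, Real.norm_of_nonneg h3]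
      exact mul_le_mul_of_nonneg_left h2 h3
    _ = _ := by ring

lemma e_eq_mul_e_sub_one {t : ℝ} (h0 : 0 < t) (h1 : t ≤ 1 / 2) :
    (1 : ℂ) = (-(1 / 2) - Complex.I / 2 * ((Real.cos (Real.pi * t) / Real.sin (Real.pi * t) : ℝ)))
      * (e t - 1) := by
  have hs : 0 < Real.sin (Real.pi * t) :=
    Real.sin_pos_of_pos_of_lt_pi (by positivity) (by nlinarith [Real.pi_pos])
  have he : e t = (Real.cos (Real.pi * t) + Real.sin (Real.pi * t) * Complex.I) ^ 2 := by
    unfold e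
    rw [Complex.ofReal_cos, Complex.ofReal_sin, ← Complex.exp_mul_I, ← Complex.exp_nat_mul]
    congr 1
    push_cast
    ring
  have hcs :
      ((Real.cos (Real.pi * t) : ℝ) : ℂ) ^ 2 + ((Real.sin (Real.pi * t) : ℝ) : ℂ) ^ 2 = 1 := by
    exact_mod_cast Real.cos_sq_add_sin_sq _
  have hs' : ((Real.sin (Real.pi * t) : ℝ) : ℂ) ≠ 0 := by exact_mod_cast hs.ne'
  rw [he]
  generalize ((Real.sin (Real.pi * t) : ℝ)) = s at *
  generalize ((Real.cos (Real.pi * t) : ℝ)) = c at *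
  push_cast
  field_simp
  have hI := Complex.I_sq
  generalize Complex.I = I at *
  linear_combination (I * c - s) * hcs + ((s + I * c) * s ^ 2 + 2 * s * c ^ 2) * hI

/-- The Kusmin–Landau inequality. -/
lemma norm_sum_e_le {a b : ℕ} {G : ℕ → ℝ} {δ : ℝ} (hδ : 0 < δ)
    (hanti : ∀ i, a ≤ i → i + 1 < b → G (i + 2) - G (i + 1) ≤ G (i + 1) - G i)
    (hlow : ∀ i, a ≤ i → i < b → δ ≤ G (i + 1) - G i)
    (hup : ∀ i, a ≤ i → i < b → G (i + 1) - G i ≤ 1 / 2) :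
    ‖∑ i ∈ Ico a b, e (G i)‖ ≤ 1 / δ := by
  rcases le_or_gt b a with hba | hab
  · rw [Ico_eq_empty_of_le hba]; simpa using hδ.le
  set D : ℕ → ℝ := fun i ↦ G (i + 1) - G i with hD
  set w : ℕ → ℝ := fun i ↦ Real.cos (Real.pi * D i) / Real.sin (Real.pi * D i) with hw
  set z : ℕ → ℂ := fun i ↦ e (G (i + 1)) - e (G i) with hz
  have hδ2 : δ ≤ 1 / 2 := (hlow a le_rfl hab).trans (hup a le_rfl hab)
  have hpi := Real.pi_pos
  have hterm : ∀ i ∈ Ico a b, e (G i) = -(1 / 2) * z i - Complex.I / 2 * (w i * z i) := by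
    intro i hi
    rw [mem_Ico] at hi
    have h1 := e_eq_mul_e_sub_one (hδ.trans_le (hlow i hi.1 hi.2)) (hup i hi.1 hi.2)
    have h2 : z i = e (G i) * (e (G (i + 1) - G i) - 1) := by
      rw [mul_sub, ← e_add]; simp [hz]
    rw [h2]
    linear_combination e (G i) * h1
  have htail : ∀ j, a ≤ j → j ≤ b → ‖∑ i ∈ Ico j b, z i‖ ≤ 2 := by
    intro j _ hj
    rw [sum_Ico_eq_sub _ hj, sum_range_sub (fun i ↦ e (G i)), sum_range_sub (fun i ↦ e (G i))]
    calc _ = ‖e (G b) - e (G j)‖ := by congr 1; ring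
      _ ≤ ‖e (G b)‖ + ‖e (G j)‖ := norm_sub_le _ _
      _ = 2 := by rw [norm_e, norm_e]; norm_num
  have hcot : ∀ s t : ℝ, 0 < s → s ≤ t → t ≤ 1 / 2 →
      Real.cos (Real.pi * t) / Real.sin (Real.pi * t) ≤
        Real.cos (Real.pi * s) / Real.sin (Real.pi * s) := by
    intro s t hs hst ht
    have h1 : 0 < Real.sin (Real.pi * s) :=
      Real.sin_pos_of_pos_of_lt_pi (by positivity) (by nlinarith)
    have h2 : Real.sin (Real.pi * s) ≤ Real.sin (Real.pi * t) :=
      Real.sin_le_sin_of_le_of_le_pi_div_two (by nlinarith) (by nlinarith) (by nlinarith)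
    have h3 : Real.cos (Real.pi * t) ≤ Real.cos (Real.pi * s) :=
      Real.cos_le_cos_of_nonneg_of_le_pi (by positivity) (by nlinarith) (by nlinarith)
    have h4 : 0 ≤ Real.cos (Real.pi * s) :=
      Real.cos_nonneg_of_mem_Icc ⟨by nlinarith, by nlinarith⟩
    exact div_le_div₀ h4 h3 h1 h2
  have hcot0 : ∀ t : ℝ, 0 < t → t ≤ 1 / 2 →
      0 ≤ Real.cos (Real.pi * t) / Real.sin (Real.pi * t) := by
    intro t h0 h1
    exact div_nonneg (Real.cos_nonneg_of_mem_Icc ⟨by nlinarith, by nlinarith⟩)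
      (Real.sin_nonneg_of_nonneg_of_le_pi (by positivity) (by nlinarith))
  have hW : Real.cos (Real.pi * δ) / Real.sin (Real.pi * δ) ≤ 1 / (2 * δ) := by
    have h1 : 2 / Real.pi * (Real.pi * δ) ≤ Real.sin (Real.pi * δ) :=
      Real.mul_le_sin (by positivity) (by nlinarith)
    have h2 : 2 / Real.pi * (Real.pi * δ) = 2 * δ := by field_simp
    rw [h2] at h1
    exact div_le_div₀ zero_le_one (Real.cos_le_one _) (by positivity) h1
  have hweight : ‖∑ i ∈ Ico a b, (w i : ℂ) * z i‖ ≤ 1 / (2 * δ) * 2 := by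
    refine norm_sum_weight_le hab.le (by norm_num) ?_ ?_ ?_ (by positivity) htail
    · intro i hi hib
      exact hcot _ _ (hδ.trans_le (hlow (i + 1) (by omega) hib)) (hanti i hi hib)
        (hup i hi (by omega))
    · intro i hi hib
      exact hcot0 _ (hδ.trans_le (hlow i hi hib)) (hup i hi hib)
    · intro i hi hib
      exact (hcot _ _ hδ (hlow i hi hib) (hup i hi hib)).trans hW
  rw [sum_congr rfl hterm, sum_sub_distrib, ← mul_sum, ← mul_sum]
  have hz2 := htail a le_rfl hab.le
  calc _ ≤ ‖-(1 / 2 : ℂ) * ∑ i ∈ Ico a b, z i‖ + ‖Complex.I / 2 * ∑ i ∈ Ico a b, (w i : ℂ) * z i‖ :=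
        norm_sub_le _ _
    _ ≤ 1 / 2 * 2 + 1 / 2 * (1 / (2 * δ) * 2) := by
        rw [norm_mul, norm_mul]
        refine add_le_add ?_ ?_
        · gcongr; simp
        · gcongr; simp
    _ ≤ 1 / δ := by
        have : 1 ≤ 1 / (2 * δ) := by rw [le_div_iff₀ (by positivity)]; linarith
        have h2 : 1 / δ = 2 * (1 / (2 * δ)) := by field_simp
        rw [h2]; linarith

/-- The Kusmin–Landau inequality for a concave differentiable phase. -/
lemma norm_sum_e_le_of_hasDerivAt {a b : ℕ} {G G' : ℝ → ℝ} {δ : ℝ} (hδ : 0 < δ)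
    (hG : ∀ t, (a : ℝ) ≤ t → HasDerivAt G (G' t) t)
    (hanti : ∀ s t, (a : ℝ) ≤ s → s ≤ t → G' t ≤ G' s)
    (hlow : δ ≤ G' b) (hup : G' a ≤ 1 / 2) :
    ‖∑ i ∈ Ico a b, e (G i)‖ ≤ 1 / δ := by
  have mvt : ∀ i : ℕ, a ≤ i → ∃ c : ℝ, (i : ℝ) < c ∧ c < i + 1 ∧ G (i + 1) - G i = G' c := by
    intro i hi
    have hi' : (a : ℝ) ≤ i := by exact_mod_cast hi
    obtain ⟨c, hc, h⟩ := exists_hasDerivAt_eq_slope G G' (lt_add_one (i : ℝ))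
      (fun t ht ↦ (hG t (hi'.trans ht.1)).continuousAt.continuousWithinAt)
      (fun t ht ↦ hG t (hi'.trans ht.1.le))
    refine ⟨c, hc.1, hc.2, ?_⟩
    rw [h]; simp
  refine norm_sum_e_le (G := fun i ↦ G i) hδ ?_ ?_ ?_
  · intro i hi _
    have hi' : (a : ℝ) ≤ i := by exact_mod_cast hi
    obtain ⟨c, h1, h2, h3⟩ := mvt i hi
    obtain ⟨d, h4, h5, h6⟩ := mvt (i + 1) (by omega)
    push_cast at *
    rw [show (i : ℝ) + 2 = i + 1 + 1 by ring, h3, h6]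
    exact hanti _ _ (by linarith) (by linarith)
  · intro i hi hib
    have hi' : (a : ℝ) ≤ i := by exact_mod_cast hi
    have hib' : (i : ℝ) + 1 ≤ b := by exact_mod_cast hib
    obtain ⟨c, h1, h2, h3⟩ := mvt i hi
    push_cast
    rw [h3]
    exact hlow.trans (hanti _ _ (by linarith) (by linarith))
  · intro i hi _
    have hi' : (a : ℝ) ≤ i := by exact_mod_cast hi
    obtain ⟨c, h1, h2, h3⟩ := mvt i hi
    push_cast
    rw [h3]
    exact (hanti _ _ le_rfl (by linarith)).trans hup

lemma one_le_log {u : ℝ} (hu : 3 ≤ u) : 1 ≤ Real.log u := by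
  rw [Real.le_log_iff_exp_le (by linarith)]
  linarith [Real.exp_one_lt_three]

lemma hasDerivAt_div_log (X : ℝ) {k t : ℝ} (hk : 0 < k) (ht : 0 < t) (hkt : 3 ≤ k * t) :
    HasDerivAt (fun t ↦ X / Real.log (k * t)) (-(X / (t * Real.log (k * t) ^ 2))) t := by
  have hl := one_le_log hkt
  have h1 : HasDerivAt (fun t ↦ Real.log (k * t)) (k * 1 / (k * t)) t :=
    ((hasDerivAt_id t).const_mul k).log (by positivity)
  simp only [div_eq_mul_inv X]
  refine ((h1.fun_inv (by positivity)).const_mul X).congr_deriv ?_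
  field_simp

lemma mul_one_div_add_one_div {u s : ℝ} (hu : u ≠ 0) (hus : u + s ≠ 0) :
    s * (1 / (u * (u + s) ^ 2) + 1 / (u ^ 2 * (u + s))) = 1 / u ^ 2 - 1 / (u + s) ^ 2 := by
  field_simp
  ring

lemma norm_sum_e_neg (s : Finset ℕ) (G : ℕ → ℝ) : ‖∑ i ∈ s, e (-G i)‖ = ‖∑ i ∈ s, e (G i)‖ := by
  rw [← Complex.norm_conj (∑ i ∈ s, e (G i)), map_sum]
  simp only [conj_e]

lemma norm_sum_e_div_log_le {X ℓ : ℝ} (hX : 0 < X) {d a b : ℕ} (ha : 3 ≤ d * a)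
    (hXa : 2 * X ≤ a) (hℓ : Real.log (d * b) ≤ ℓ) :
    ‖∑ m ∈ Ico a b, e (X / Real.log (d * m))‖ ≤ b * ℓ ^ 2 / X := by
  rcases le_or_gt b a with hba | hab
  · rw [Ico_eq_empty_of_le hba]; simp; positivity
  have hd : 0 < d := Nat.pos_of_ne_zero (by rintro rfl; simp at ha)
  have ha0 : 0 < a := Nat.pos_of_ne_zero (by rintro rfl; simp at ha)
  have hd' : (0 : ℝ) < d := by exact_mod_cast hd
  have ha0' : (0 : ℝ) < a := by exact_mod_cast ha0
  have hab' : (a : ℝ) ≤ b := by exact_mod_cast hab.le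
  have ha' : (3 : ℝ) ≤ d * a := by exact_mod_cast ha
  have h3 : ∀ t : ℝ, (a : ℝ) ≤ t → 3 ≤ d * t := fun t ht ↦ ha'.trans (by gcongr)
  have hb0 : (0 : ℝ) < b := ha0'.trans_le hab'
  have hlb := one_le_log (h3 b hab')
  have hℓ1 : 1 ≤ ℓ := hlb.trans hℓ
  rw [← norm_sum_e_neg, show b * ℓ ^ 2 / X = 1 / (X / (b * ℓ ^ 2)) by field_simp]
  refine norm_sum_e_le_of_hasDerivAt (G := fun t ↦ -(X / Real.log (d * t)))
    (G' := fun t ↦ X / (t * Real.log (d * t) ^ 2)) (by positivity) ?_ ?_ ?_ ?_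
  · intro t ht
    simpa using (hasDerivAt_div_log X hd' (ha0'.trans_le ht) (h3 t ht)).fun_neg
  · intro s t hs hst
    have hl := one_le_log (h3 s hs)
    have hs0 := ha0'.trans_le hs
    have ht0 := hs0.trans_le hst
    gcongr
  · gcongr
  · have hl := one_le_log (h3 a le_rfl)
    rw [div_le_iff₀ (by positivity)]
    nlinarith [one_le_pow₀ hl (n := 2)]

lemma norm_sum_e_div_log_sub_le {X ℓ : ℝ} (hX : 0 < X) {j k a b : ℕ} (hjk : j < k)
    (ha : 3 ≤ j * a) (hXa : 2 * X ≤ a) (hℓ : Real.log (k * b) ≤ ℓ) :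
    ‖∑ m ∈ Ico a b, e (X / Real.log (j * m) - X / Real.log (k * m))‖ ≤
      b * ℓ ^ 3 * k / (X * (k - j)) := by
  have hjk' : (0 : ℝ) < k - j := sub_pos.2 (by exact_mod_cast hjk)
  rcases le_or_gt b a with hba | hab
  · rw [Ico_eq_empty_of_le hba]
    rcases b.eq_zero_or_pos with rfl | hb
    · simp
    have hk : 1 ≤ k * b := Nat.mul_pos (by omega) hb
    have : 0 ≤ ℓ := (Real.log_nonneg (by exact_mod_cast hk)).trans hℓ
    simp only [sum_empty, norm_zero]
    positivity
  have hj : 0 < j := Nat.pos_of_ne_zero (by rintro rfl; simp at ha)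
  have ha0 : 0 < a := Nat.pos_of_ne_zero (by rintro rfl; simp at ha)
  have hj' : (0 : ℝ) < j := by exact_mod_cast hj
  have hk' : (0 : ℝ) < k := by linarith
  have ha0' : (0 : ℝ) < a := by exact_mod_cast ha0
  have hab' : (a : ℝ) ≤ b := by exact_mod_cast hab.le
  have ha' : (3 : ℝ) ≤ j * a := by exact_mod_cast ha
  have h3 : ∀ t : ℝ, (a : ℝ) ≤ t → 3 ≤ j * t := fun t ht ↦ ha'.trans (by gcongr)
  have h3k : ∀ t : ℝ, (a : ℝ) ≤ t → 3 ≤ k * t := fun t ht ↦ (h3 t ht).trans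
    (mul_le_mul_of_nonneg_right (by linarith) (ha0'.le.trans ht))
  have hb0 : (0 : ℝ) < b := ha0'.trans_le hab'
  have hlb := one_le_log (h3k b hab')
  have hℓ1 : 1 ≤ ℓ := hlb.trans hℓ
  set s : ℝ := Real.log (k / j) with hs
  have hs1 : (k - j) / k ≤ s := by
    have := Real.one_sub_inv_le_log_of_pos (x := (k : ℝ) / j) (by positivity)
    refine le_trans (le_of_eq ?_) this
    field_simp
  have hs0 : 0 < s := lt_of_lt_of_le (by positivity) hs1
  have hlog : ∀ t : ℝ, (a : ℝ) ≤ t → Real.log (k * t) = Real.log (j * t) + s := by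
    intro t ht
    have ht0 := ha0'.trans_le ht
    rw [hs, ← Real.log_mul (by positivity) (by positivity)]
    congr 1
    field_simp
  rw [← norm_sum_e_neg, show b * ℓ ^ 3 * k / (X * (k - j)) = 1 / (X / b * ((k - j) / k *
    (1 / ℓ ^ 3))) by field_simp]
  refine norm_sum_e_le_of_hasDerivAt
    (G := fun t ↦ -(X / Real.log (j * t) - X / Real.log (k * t)))
    (G' := fun t ↦ X / t * (s * (1 / (Real.log (j * t) * Real.log (k * t) ^ 2) +
      1 / (Real.log (j * t) ^ 2 * Real.log (k * t))))) (by positivity) ?_ ?_ ?_ ?_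
  · intro t ht
    have ht0 := ha0'.trans_le ht
    have h1 := ((hasDerivAt_div_log X hj' ht0 (h3 t ht)).fun_sub
      (hasDerivAt_div_log X hk' ht0 (h3k t ht))).fun_neg
    refine h1.congr_deriv ?_
    have hl := one_le_log (h3 t ht)
    have hl' := one_le_log (h3k t ht)
    rw [hlog t ht] at hl' ⊢
    rw [mul_one_div_add_one_div (by positivity) (by positivity)]
    field_simp
    ring
  · intro u t hu hut
    have hl := one_le_log (h3 u hu)
    have hl' := one_le_log (h3k u hu)
    have hu0 := ha0'.trans_le hu
    have ht0 := hu0.trans_le hut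
    have hlt := one_le_log (h3 t (hu.trans hut))
    have hlt' := one_le_log (h3k t (hu.trans hut))
    gcongr
  · have hl := one_le_log (h3 b hab')
    have hjl : Real.log (j * b) ≤ ℓ := by linarith [hlog b hab']
    gcongr
    calc 1 / ℓ ^ 3 = 1 / (ℓ * ℓ ^ 2) := by ring
      _ ≤ 1 / (Real.log (j * b) * Real.log (k * b) ^ 2) := by gcongr
      _ ≤ _ := le_add_of_nonneg_right (by positivity)
  · have hl := one_le_log (h3 a le_rfl)
    have hl' := one_le_log (h3k a le_rfl)
    have heq : s * (1 / (Real.log (j * a) * Real.log (k * a) ^ 2) +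
      1 / (Real.log (j * a) ^ 2 * Real.log (k * a))) =
        1 / Real.log (j * a) ^ 2 - 1 / Real.log (k * a) ^ 2 := by
      rw [hlog a le_rfl] at hl' ⊢
      exact mul_one_div_add_one_div (by positivity) (by positivity)
    have h1 : 1 / Real.log (j * a) ^ 2 ≤ 1 := by
      rw [div_le_one (by positivity)]; exact one_le_pow₀ hl
    have h2 : 0 ≤ 1 / Real.log (k * a) ^ 2 := by positivity
    rw [heq]
    calc _ ≤ X / a * 1 := by gcongr; linarith
      _ ≤ 1 / 2 := by rw [mul_one, div_le_iff₀ ha0']; linarith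

lemma norm_sum_mul_e_div_log_sub_le {X ℓ : ℝ} (hX : 0 < X) {j k a b : ℕ} (hjk : j < k)
    (ha : 3 ≤ j * a) (hXa : 2 * X ≤ a) (hℓ : Real.log (k * b) ≤ ℓ) :
    ‖∑ m ∈ Ico a b, ((m : ℝ) : ℂ) * e (X / Real.log (j * m) - X / Real.log (k * m))‖ ≤
      b * (b * ℓ ^ 3 * k / (X * (k - j))) := by
  rcases le_or_gt b a with hba | hab
  · rw [Ico_eq_empty_of_le hba, sum_empty, norm_zero]
    have := (norm_nonneg _).trans (norm_sum_e_div_log_sub_le hX hjk ha hXa hℓ)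
    positivity
  refine norm_sum_weight_le hab.le ((norm_nonneg _).trans
    (norm_sum_e_div_log_sub_le hX hjk ha hXa hℓ)) ?_ ?_ ?_ (by positivity) ?_
  · intro i _ _; push_cast; linarith
  · intro i _ _; positivity
  · intro i _ hi; exact_mod_cast hi.le
  · intro i hai _
    exact norm_sum_e_div_log_sub_le hX hjk (ha.trans (Nat.mul_le_mul_left _ hai))
      (hXa.trans (by exact_mod_cast hai)) hℓ

lemma norm_sum_log_mul_e_div_log_le {X ℓ : ℝ} (hX : 0 < X) {d a b : ℕ} (ha : 3 ≤ d * a)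
    (hXa : 2 * X ≤ a) (hℓ : Real.log (d * b) ≤ ℓ) :
    ‖∑ m ∈ Ico a b, (Real.log m : ℂ) * e (X / Real.log (d * m))‖ ≤
      Real.log b * (b * ℓ ^ 2 / X) := by
  have hlb : 0 ≤ Real.log b := Real.log_natCast_nonneg b
  have ha0 : 0 < a := Nat.pos_of_ne_zero (by rintro rfl; simp at ha)
  rcases le_or_gt b a with hba | hab
  · rw [Ico_eq_empty_of_le hba, sum_empty, norm_zero]
    positivity
  refine norm_sum_weight_le hab.le ((norm_nonneg _).trans
    (norm_sum_e_div_log_le hX ha hXa hℓ)) ?_ ?_ ?_ hlb ?_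
  · intro i hi _
    have : (0 : ℝ) < i := by exact_mod_cast ha0.trans_le hi
    gcongr
    simp
  · intro i _ _; exact Real.log_natCast_nonneg i
  · intro i hai hi
    have : (0 : ℝ) < i := by exact_mod_cast ha0.trans_le hai
    gcongr
  · intro i hai _
    exact norm_sum_e_div_log_le hX (ha.trans (Nat.mul_le_mul_left _ hai))
      (hXa.trans (by exact_mod_cast hai)) hℓ

open ArithmeticFunction ArithmeticFunction.zeta ArithmeticFunction.Moebius

lemma sum_Ioc_mul_mul_eq (f g : ArithmeticFunction ℝ) (F : ℕ → ℂ) (y N : ℕ) :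
    ∑ n ∈ Ioc y N, ((f * g) n : ℂ) * F n =
      ∑ d ∈ Ioc 0 N, (f d : ℂ) *
        ∑ m ∈ Ico (y / d + 1) (N / d + 1), (g m : ℂ) * F (d * m) := by
  have h1 : ∀ n ∈ Ioc y N, ((f * g) n : ℂ) * F n =
      ∑ x ∈ Ioc 0 N ×ˢ Ioc 0 N with x.1 * x.2 = n, (f x.1 : ℂ) * ((g x.2 : ℂ) * F (x.1 * x.2)) := by
    intro n hn
    rw [mem_Ioc] at hn
    rw [mul_apply, Nat.divisorsAntidiagonal_eq_prod_filter_of_le (by omega) hn.2]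
    push_cast
    rw [sum_mul]
    refine sum_congr rfl fun x hx ↦ ?_
    rw [(mem_filter.1 hx).2, mul_assoc]
  rw [sum_congr rfl h1]
  simp_rw [sum_filter]
  rw [sum_comm, sum_product]
  refine sum_congr rfl fun d hd ↦ ?_
  rw [mem_Ioc] at hd
  rw [mul_sum]
  simp only [sum_ite_eq, mem_Ioc]
  rw [← sum_filter]
  refine sum_congr ?_ fun _ _ ↦ rfl
  ext m
  simp only [mem_filter, mem_Ioc, mem_Ico, Nat.succ_le_iff, Nat.lt_succ_iff,
    Nat.div_lt_iff_lt_mul hd.1, Nat.le_div_iff_mul_le hd.1, mul_comm d]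
  constructor
  · rintro ⟨-, h⟩; exact h
  · rintro ⟨h1, h2⟩
    refine ⟨⟨Nat.pos_of_ne_zero ?_, ?_⟩, h1, h2⟩
    · rintro rfl; simp at h1
    · exact (Nat.le_mul_of_pos_right m hd.1).trans h2

lemma sum_Ioc_one_div_le (N : ℕ) : ∑ i ∈ Ioc 0 N, 1 / (i : ℝ) ≤ 1 + Real.log N := by
  have h := harmonic_le_one_add_log N
  rw [harmonic_eq_sum_Icc] at h
  push_cast at h
  simpa [one_div, ← Finset.Icc_add_one_left_eq_Ioc] using h

/-- Truncation of an arithmetic function to arguments `≤ V`. -/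
def trunc (f : ArithmeticFunction ℝ) (V : ℕ) : ArithmeticFunction ℝ :=
  ⟨fun n ↦ if n ≤ V then f n else 0, by simp⟩

lemma trunc_apply (f : ArithmeticFunction ℝ) (V n : ℕ) :
    trunc f V n = if n ≤ V then f n else 0 := rfl

lemma sub_trunc_apply (f : ArithmeticFunction ℝ) (V n : ℕ) :
    (f - trunc f V) n = if n ≤ V then 0 else f n := by
  have h : (f - trunc f V) n + trunc f V n = f n := by
      rw [← ArithmeticFunction.add_apply, sub_add_cancel]
  rw [trunc_apply] at h
  split_ifs at h ⊢ <;> linarith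

/-- Vaughan's identity. -/
lemma vaughan (V : ℕ) :
    Λ = trunc Λ V + trunc μ V * log - trunc μ V * trunc Λ V * ζ +
      ((μ : ArithmeticFunction ℝ) - trunc μ V) * ((Λ - trunc Λ V) * ζ) := by
  have h1 : (Λ : ArithmeticFunction ℝ) * ζ = log := vonMangoldt_mul_zeta
  have h2 : (μ : ArithmeticFunction ℝ) * ζ = 1 := coe_moebius_mul_coe_zeta
  linear_combination (trunc μ V) * h1 - (Λ - trunc Λ V) * h2

lemma abs_moebius_le (n : ℕ) : |(μ : ArithmeticFunction ℝ) n| ≤ 1 := by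
  rw [intCoe_apply]
  exact_mod_cast abs_moebius_le_one

lemma abs_trunc_moebius_le (V n : ℕ) : |trunc μ V n| ≤ 1 := by
  rw [trunc_apply]
  split_ifs
  · exact abs_moebius_le n
  · simp

lemma abs_trunc_vonMangoldt_le (V n : ℕ) : |trunc Λ V n| ≤ Λ n := by
  rw [trunc_apply]
  split_ifs
  · rw [abs_of_nonneg vonMangoldt_nonneg]
  · simp

lemma abs_sub_trunc_vonMangoldt_le (V n : ℕ) : |(Λ - trunc Λ V) n| ≤ Λ n := by
  rw [sub_trunc_apply]
  split_ifs
  · simp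
  · rw [abs_of_nonneg vonMangoldt_nonneg]

lemma abs_mul_le_log {f g : ArithmeticFunction ℝ} (hf : ∀ n, |f n| ≤ 1) (hg : ∀ n, |g n| ≤ Λ n)
    (n : ℕ) : |(f * g) n| ≤ Real.log n := by
  rw [mul_apply, ← vonMangoldt_sum, ← Nat.sum_divisorsAntidiagonal' (fun _ j ↦ Λ j)]
  refine (abs_sum_le_sum_abs _ _).trans (sum_le_sum fun x _ ↦ ?_)
  rw [abs_mul]
  exact (mul_le_mul (hf _) (hg _) (abs_nonneg _) zero_le_one).trans (one_mul _).le

lemma trunc_mul_trunc_eq_zero (f g : ArithmeticFunction ℝ) {V n : ℕ} (hn : V ^ 2 < n) :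
    (trunc f V * trunc g V) n = 0 := by
  rw [mul_apply]
  refine sum_eq_zero fun x hx ↦ ?_
  have hx := (Nat.mem_divisorsAntidiagonal.1 hx).1
  rw [trunc_apply, trunc_apply]
  split_ifs with h1 h2
  · nlinarith [Nat.mul_le_mul h1 h2]
  all_goals simp

/-- A bilinear form inequality: Cauchy–Schwarz followed by opening the square. -/
lemma norm_sum_mul_sum_sq_le (s t : Finset ℕ) (hs : ∀ d ∈ s, 0 < d) {α : ℕ → ℂ}
    (hα : ∀ d, ‖α d‖ ≤ 1) (c : ℕ → ℂ) (a : ℕ → ℕ → ℂ) :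
    ‖∑ d ∈ s, α d * ∑ j ∈ t, c j * a d j‖ ^ 2 ≤ (∑ d ∈ s, 1 / (d : ℝ)) *
      ∑ j ∈ t, ∑ k ∈ t, ‖c j‖ * ‖c k‖ * ‖∑ d ∈ s, ((d : ℝ) : ℂ) * (a d j * conj (a d k))‖ := by
  set S : ℕ → ℂ := fun d ↦ ∑ j ∈ t, c j * a d j with hS
  have h1 : ‖∑ d ∈ s, α d * S d‖ ≤ ∑ d ∈ s, ‖S d‖ := by
    refine norm_sum_le_of_le _ fun d _ ↦ ?_
    rw [norm_mul]
    exact mul_le_of_le_one_left (norm_nonneg _) (hα d)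
  have h2 : (∑ d ∈ s, ‖S d‖) ^ 2 ≤ (∑ d ∈ s, 1 / (d : ℝ)) * ∑ d ∈ s, d * ‖S d‖ ^ 2 := by
    refine sum_sq_le_sum_mul_sum_of_sq_le_mul s (fun d _ ↦ by positivity)
      (fun d _ ↦ by positivity) fun d hd ↦ ?_
    have : (0 : ℝ) < d := by exact_mod_cast hs d hd
    refine le_of_eq ?_
    field_simp
  have h3 : ((∑ d ∈ s, d * ‖S d‖ ^ 2 : ℝ) : ℂ) =
      ∑ j ∈ t, ∑ k ∈ t, c j * conj (c k) * ∑ d ∈ s, ((d : ℝ) : ℂ) * (a d j * conj (a d k)) := by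
    have h4 : ∀ d, ((d * ‖S d‖ ^ 2 : ℝ) : ℂ) = ∑ j ∈ t, ∑ k ∈ t,
        c j * conj (c k) * (((d : ℝ) : ℂ) * (a d j * conj (a d k))) := by
      intro d
      push_cast
      rw [← Complex.mul_conj', hS, map_sum, sum_mul_sum, mul_sum]
      refine sum_congr rfl fun j _ ↦ ?_
      rw [mul_sum]
      refine sum_congr rfl fun k _ ↦ ?_
      rw [map_mul]
      ring
    rw [Complex.ofReal_sum, sum_congr rfl fun d _ ↦ h4 d, sum_comm]
    refine sum_congr rfl fun j _ ↦ ?_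
    rw [sum_comm]
    simp_rw [mul_sum]
  have h5 : ∑ d ∈ s, d * ‖S d‖ ^ 2 ≤
      ∑ j ∈ t, ∑ k ∈ t, ‖c j‖ * ‖c k‖ * ‖∑ d ∈ s, ((d : ℝ) : ℂ) * (a d j * conj (a d k))‖ := by
    have h6 : 0 ≤ ∑ d ∈ s, d * ‖S d‖ ^ 2 := sum_nonneg fun d _ ↦ by positivity
    rw [← Real.norm_of_nonneg h6, ← Complex.norm_real, h3]
    refine norm_sum_le_of_le _ fun j _ ↦ norm_sum_le_of_le _ fun k _ ↦ ?_
    rw [norm_mul, norm_mul, Complex.norm_conj]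
  calc _ ≤ (∑ d ∈ s, ‖S d‖) ^ 2 := by gcongr
    _ ≤ _ := h2
    _ ≤ _ := by gcongr

lemma lt_mul_div_add_one {d : ℕ} (hd : 0 < d) (y : ℕ) : y < d * (y / d + 1) := by
  rw [mul_comm, ← Nat.div_lt_iff_lt_mul hd]
  exact Nat.lt_succ_self _

lemma div_add_one_le {d N : ℕ} (hd : 0 < d) (hdN : d ≤ N) :
    ((N / d + 1 : ℕ) : ℝ) ≤ 2 * N / d := by
  have h : d * (N / d + 1) ≤ 2 * N := by
    have := Nat.mul_div_le N d
    rw [mul_add]; omega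
  rw [le_div_iff₀ (by exact_mod_cast hd), mul_comm]
  exact_mod_cast h

lemma log_mul_div_add_one_le {d N : ℕ} (hd : 0 < d) (hdN : d ≤ N) :
    Real.log (d * (N / d + 1 : ℕ)) ≤ Real.log (2 * N) := by
  have hd' : (0 : ℝ) < d := by exact_mod_cast hd
  refine Real.log_le_log (by positivity) ?_
  have := div_add_one_le hd hdN
  rwa [le_div_iff₀ hd', mul_comm] at this

lemma le_div_add_one {X : ℝ} {d D y : ℕ} (hd : 0 < d) (hdD : d ≤ D) (h : 2 * X * D ≤ y)
    (hX : 0 < X) : 2 * X ≤ (y / d + 1 : ℕ) := by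
  have h1 : (y : ℝ) ≤ d * (y / d + 1 : ℕ) := by exact_mod_cast (lt_mul_div_add_one hd y).le
  have hd' : (0 : ℝ) < d := by exact_mod_cast hd
  have hdD' : (d : ℝ) ≤ D := by exact_mod_cast hdD
  have h2 : 2 * X * d ≤ y := (by gcongr : 2 * X * d ≤ 2 * X * D).trans h
  rw [mul_comm] at h2
  exact le_of_mul_le_mul_left (h2.trans h1) hd'

/-- A sum over `d ≤ D` of inner sums of size `T / d`. -/
lemma norm_sum_mul_le_of_support {α : ℕ → ℝ} {S : ℕ → ℂ} {D N : ℕ} {A T ℓ : ℝ} (hA : 0 ≤ A)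
    (hT : 0 ≤ T) (hℓ : 1 ≤ ℓ) (hN : Real.log N ≤ ℓ)
    (hα : ∀ d ∈ Ioc 0 N, |α d| ≤ A) (hα0 : ∀ d, D < d → α d = 0)
    (hS : ∀ d, 0 < d → d ≤ D → d ≤ N → ‖S d‖ ≤ T / d) :
    ‖∑ d ∈ Ioc 0 N, (α d : ℂ) * S d‖ ≤ A * T * (2 * ℓ) := by
  have h1 : ∀ d ∈ Ioc 0 N, ‖(α d : ℂ) * S d‖ ≤ A * T * (1 / (d : ℝ)) := by
    intro d hd
    have hαd := hα d hd
    rw [mem_Ioc] at hd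
    rcases lt_or_ge D d with h | h
    · rw [hα0 d h]; simp; positivity
    rw [norm_mul, Complex.norm_real, Real.norm_eq_abs]
    calc _ ≤ A * (T / d) := mul_le_mul hαd (hS d hd.1 h hd.2) (norm_nonneg _) hA
      _ = _ := by ring
  refine (norm_sum_le_of_le _ h1).trans ?_
  rw [← mul_sum]
  gcongr
  linarith [sum_Ioc_one_div_le N]

section Bilinear

variable (X : ℝ) (y N : ℕ)

/-- The kernel of the bilinear form: `e (X / log (dj))` restricted to `y < dj ≤ N`. -/
def kernel (d j : ℕ) : ℂ :=
  if y < d * j ∧ d * j ≤ N then e (X / Real.log (d * j)) else 0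

lemma kernel_mul_conj (d j k : ℕ) : kernel X y N d j * conj (kernel X y N d k) =
    if (y < d * j ∧ d * j ≤ N) ∧ (y < d * k ∧ d * k ≤ N) then
      e (X / Real.log (j * d) - X / Real.log (k * d)) else 0 := by
  unfold kernel
  rw [e_sub, mul_comm (j : ℝ), mul_comm (k : ℝ)]
  split_ifs <;> simp_all

variable {X y N}

lemma norm_sum_kernel_symm (s : Finset ℕ) (j k : ℕ) :
    ‖∑ d ∈ s, ((d : ℝ) : ℂ) * (kernel X y N d j * conj (kernel X y N d k))‖ =
      ‖∑ d ∈ s, ((d : ℝ) : ℂ) * (kernel X y N d k * conj (kernel X y N d j))‖ := by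
  rw [← Complex.norm_conj, map_sum]
  congr 1
  refine sum_congr rfl fun d _ ↦ ?_
  rw [map_mul, map_mul, Complex.conj_conj, Complex.conj_ofReal, mul_comm (kernel X y N d k)]

lemma norm_sum_kernel_le {V : ℕ} (hX : 1 ≤ X) (hy : 3 ≤ y) (hV : 2 * X ≤ V) {j k : ℕ}
    (hj : 0 < j) (hjk : j < k) (hkN : k ≤ N) :
    ‖∑ d ∈ Ioc V N, ((d : ℝ) : ℂ) * (kernel X y N d j * conj (kernel X y N d k))‖ ≤
      4 * N ^ 2 * Real.log (2 * N) ^ 3 / X * (1 / (k * (k - j))) := by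
  have hk : 0 < k := hj.trans hjk
  have hk' : (0 : ℝ) < k := by exact_mod_cast hk
  have hX0 : 0 < X := by linarith
  have hjk' : (0 : ℝ) < k - j := sub_pos.2 (by exact_mod_cast hjk)
  have hN : 1 ≤ N := by omega
  have hN' : (1 : ℝ) ≤ N := by exact_mod_cast hN
  have hl : 0 ≤ Real.log (2 * N) := Real.log_nonneg (by linarith)
  have hset : ∑ d ∈ Ioc V N, ((d : ℝ) : ℂ) * (kernel X y N d j * conj (kernel X y N d k)) =
      ∑ d ∈ Ico (max V (y / j) + 1) (N / k + 1),
        ((d : ℝ) : ℂ) * e (X / Real.log (j * d) - X / Real.log (k * d)) := by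
    simp_rw [kernel_mul_conj, mul_ite, mul_zero]
    rw [← sum_filter]
    refine sum_congr ?_ fun _ _ ↦ rfl
    ext d
    simp only [mem_filter, mem_Ioc, mem_Ico, Nat.succ_le_iff, Nat.lt_succ_iff, max_lt_iff,
      Nat.div_lt_iff_lt_mul hj, Nat.le_div_iff_mul_le hk]
    have h1 : d * j ≤ d * k := Nat.mul_le_mul_left _ hjk.le
    have h2 : d ≤ d * k := Nat.le_mul_of_pos_right d hk
    constructor
    · rintro ⟨⟨h3, h4⟩, ⟨h5, h6⟩, h7, h8⟩; exact ⟨⟨h3, h5⟩, h8⟩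
    · rintro ⟨⟨h3, h5⟩, h8⟩
      exact ⟨⟨h3, h2.trans h8⟩, ⟨h5, h1.trans h8⟩, h5.trans_le h1, h8⟩
  rw [hset]
  refine (norm_sum_mul_e_div_log_sub_le hX0 hjk ?_ ?_ (log_mul_div_add_one_le hk hkN)).trans ?_
  · have h1 := lt_mul_div_add_one hj y
    have h2 : j * (y / j + 1) ≤ j * (max V (y / j) + 1) :=
      Nat.mul_le_mul_left _ (by omega)
    omega
  · refine hV.trans ?_
    exact_mod_cast (le_max_left V (y / j)).trans (Nat.le_succ _)
  · have hb := div_add_one_le hk hkN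
    calc _ ≤ (2 * N / k : ℝ) * ((2 * N / k) * Real.log (2 * N) ^ 3 * k / (X * (k - j))) := by
          gcongr
      _ = _ := by field_simp; ring

lemma norm_sum_kernel_self_le {V j : ℕ} (hj : 0 < j) :
    ‖∑ d ∈ Ioc V N, ((d : ℝ) : ℂ) * (kernel X y N d j * conj (kernel X y N d j))‖ ≤
      (N / j : ℝ) ^ 2 := by
  have hj' : (0 : ℝ) < j := by exact_mod_cast hj
  have h1 : ∀ d ∈ Ioc V N, ‖((d : ℝ) : ℂ) * (kernel X y N d j * conj (kernel X y N d j))‖ ≤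
      if d ∈ Ioc 0 (N / j) then (N / j : ℝ) else 0 := by
    intro d hd
    have hd0 : 0 < d := by rw [mem_Ioc] at hd; omega
    rw [kernel_mul_conj]
    split_ifs with h2 h3 h3
    · rw [norm_mul, norm_e, mul_one, Complex.norm_real, Real.norm_of_nonneg (by positivity),
        le_div_iff₀ hj']
      exact_mod_cast h2.1.2
    · exact absurd (mem_Ioc.2 ⟨hd0, (Nat.le_div_iff_mul_le hj).2 h2.1.2⟩) h3
    · simp only [mul_zero, norm_zero]; positivity
    · simp
  refine (norm_sum_le_of_le _ h1).trans ?_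
  rw [← sum_filter, sum_const, nsmul_eq_mul, sq]
  gcongr
  have h2 : #{d ∈ Ioc V N | d ∈ Ioc 0 (N / j)} ≤ N / j := by
    calc _ ≤ #(Ioc 0 (N / j)) := card_le_card fun d hd ↦ (mem_filter.1 hd).2
      _ = N / j := by simp
  exact (Nat.cast_le.2 h2).trans Nat.cast_div_le

lemma sum_one_div_abs_sub_le {j N : ℕ} (hj : j ≤ N) :
    ∑ k ∈ (Ioc 0 N).erase j, 1 / |(k : ℝ) - j| ≤ 2 * (1 + Real.log N) := by
  have key : ∀ (s : Finset ℕ) (g : ℕ → ℕ), Set.InjOn g s → (∀ k ∈ s, g k ∈ Ioc 0 N) →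
      (∀ k ∈ s, |(k : ℝ) - j| = g k) →
      ∑ k ∈ s, 1 / |(k : ℝ) - j| ≤ 1 + Real.log N := by
    intro s g hg hmem habs
    calc _ = ∑ i ∈ s.image g, 1 / (i : ℝ) := by
          rw [sum_image hg]
          exact sum_congr rfl fun k hk ↦ by rw [habs k hk]
      _ ≤ ∑ i ∈ Ioc 0 N, 1 / (i : ℝ) :=
          sum_le_sum_of_subset_of_nonneg (image_subset_iff.2 hmem) fun _ _ _ ↦ by positivity
      _ ≤ _ := sum_Ioc_one_div_le N
  rw [← sum_filter_add_sum_filter_not _ (fun k ↦ k < j), two_mul]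
  refine add_le_add (key _ (fun k ↦ j - k) ?_ ?_ ?_) (key _ (fun k ↦ k - j) ?_ ?_ ?_)
  · intro k hk l hl h
    simp only [coe_filter, Set.mem_ofPred_eq] at hk hl h
    omega
  · intro k hk
    simp only [mem_filter, mem_erase, mem_Ioc] at hk ⊢
    omega
  · intro k hk
    simp only [mem_filter] at hk
    have : (k : ℝ) ≤ j := by exact_mod_cast hk.2.le
    rw [Nat.cast_sub hk.2.le, abs_of_nonpos (by linarith)]
    ring
  · intro k hk l hl h
    simp only [coe_filter, Set.mem_ofPred_eq] at hk hl h
    omega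
  · intro k hk
    simp only [mem_filter, mem_erase, mem_Ioc] at hk ⊢
    omega
  · intro k hk
    simp only [mem_filter, not_lt] at hk
    have : (j : ℝ) ≤ k := by exact_mod_cast hk.2
    rw [Nat.cast_sub hk.2, abs_of_nonneg (by linarith)]

lemma norm_sum_kernel_le_of_ne {V : ℕ} (hX : 1 ≤ X) (hy : 3 ≤ y) (hV : 2 * X ≤ V) {j k : ℕ}
    (hj : 0 < j) (hk : 0 < k) (hjk : k ≠ j) (hjN : j ≤ N) (hkN : k ≤ N) :
    ‖∑ d ∈ Ioc V N, ((d : ℝ) : ℂ) * (kernel X y N d j * conj (kernel X y N d k))‖ ≤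
      4 * N ^ 2 * Real.log (2 * N) ^ 3 / X * (1 / j * (1 / |(k : ℝ) - j|)) := by
  have hX0 : 0 < X := by linarith
  have hj' : (0 : ℝ) < j := by exact_mod_cast hj
  have hk' : (0 : ℝ) < k := by exact_mod_cast hk
  have hN' : (1 : ℝ) ≤ N := by exact_mod_cast hj.trans_le hjN
  have hl : 0 ≤ Real.log (2 * N) := Real.log_nonneg (by linarith)
  rcases lt_or_gt_of_ne hjk with h | h
  · have h' : (0 : ℝ) < j - k := sub_pos.2 (by exact_mod_cast h)
    rw [norm_sum_kernel_symm]
    refine (norm_sum_kernel_le hX hy hV hk h hjN).trans (le_of_eq ?_)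
    rw [abs_of_neg (by linarith), neg_sub]
    field_simp
  · have h' : (j : ℝ) < k := by exact_mod_cast h
    have h'' : 0 < (k : ℝ) - j := sub_pos.2 h'
    refine (norm_sum_kernel_le hX hy hV hj h hkN).trans ?_
    rw [abs_of_pos (by linarith), one_div_mul_one_div]
    gcongr

/-- The Type II estimate. -/
lemma norm_sum_bilinear_le {V : ℕ} (hX : 1 ≤ X) (hy : 3 ≤ y) (hV : 2 * X ≤ V) (hyN : y ≤ N)
    {α : ℕ → ℂ} (hα : ∀ d, ‖α d‖ ≤ 1) {β : ℕ → ℂ}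
    (hβ : ∀ j, 0 < j → j ≤ N → ‖β j‖ ≤ Real.log (2 * N)) :
    ‖∑ d ∈ Ioc V N, α d * ∑ j ∈ Ioc V N, β j * kernel X y N d j‖ ≤
      9 * N * Real.log (2 * N) ^ 4 / √X := by
  have hX0 : 0 < X := by linarith
  have hV0 : (0 : ℝ) < V := by linarith
  have hN3 : (3 : ℝ) ≤ N := by exact_mod_cast hy.trans hyN
  set ℓ := Real.log (2 * N) with hℓ
  have hℓ1 : 1 ≤ ℓ := one_le_log (by linarith)
  have hlogN : Real.log N ≤ ℓ := Real.log_le_log (by linarith) (by linarith)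
  have hharm : ∑ i ∈ Ioc V N, 1 / (i : ℝ) ≤ 2 * ℓ := by
    refine (sum_le_sum_of_subset_of_nonneg (Ioc_subset_Ioc_left (Nat.zero_le V))
      fun _ _ _ ↦ by positivity).trans ((sum_Ioc_one_div_le N).trans ?_)
    linarith
  have hinner : ∀ j ∈ Ioc V N, ∑ k ∈ Ioc V N, ‖β j‖ * ‖β k‖ *
      ‖∑ d ∈ Ioc V N, ((d : ℝ) : ℂ) * (kernel X y N d j * conj (kernel X y N d k))‖ ≤
      17 * N ^ 2 * ℓ ^ 6 / X * (1 / j) := by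
    intro j hj
    have hj1 := mem_Ioc.1 hj
    have hj0 : 0 < j := by omega
    have hj' : (0 : ℝ) < j := by exact_mod_cast hj0
    have hVj : (V : ℝ) ≤ j := by exact_mod_cast hj1.1.le
    have hself : ‖β j‖ * ‖β j‖ *
        ‖∑ d ∈ Ioc V N, ((d : ℝ) : ℂ) * (kernel X y N d j * conj (kernel X y N d j))‖ ≤
        ℓ ^ 6 * (N ^ 2 / X * (1 / j)) := by
      calc _ ≤ ℓ * ℓ * (N / j : ℝ) ^ 2 := by
            gcongr
            · exact hβ j hj0 hj1.2
            · exact hβ j hj0 hj1.2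
            · exact norm_sum_kernel_self_le hj0
        _ = ℓ ^ 2 * (N ^ 2 / j * (1 / j)) := by field_simp
        _ ≤ _ := by
            gcongr
            · norm_num
            · linarith
    have hoff : ∑ k ∈ (Ioc V N).erase j, ‖β j‖ * ‖β k‖ *
        ‖∑ d ∈ Ioc V N, ((d : ℝ) : ℂ) * (kernel X y N d j * conj (kernel X y N d k))‖ ≤
        ℓ * ℓ * (4 * N ^ 2 * ℓ ^ 3 / X * (1 / j * (2 * (2 * ℓ)))) := by
      have h1 : ∀ k ∈ (Ioc V N).erase j, ‖β j‖ * ‖β k‖ *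
          ‖∑ d ∈ Ioc V N, ((d : ℝ) : ℂ) * (kernel X y N d j * conj (kernel X y N d k))‖ ≤
          ℓ * ℓ * (4 * N ^ 2 * ℓ ^ 3 / X * (1 / j * (1 / |(k : ℝ) - j|))) := by
        intro k hk
        rw [mem_erase, mem_Ioc] at hk
        have hk0 : 0 < k := by omega
        gcongr
        · exact hβ j hj0 hj1.2
        · exact hβ k hk0 hk.2.2
        · exact norm_sum_kernel_le_of_ne hX hy hV hj0 hk0 hk.1 hj1.2 hk.2.2
      refine (sum_le_sum h1).trans ?_
      simp_rw [← mul_sum]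
      gcongr
      calc _ ≤ ∑ k ∈ (Ioc 0 N).erase j, 1 / |(k : ℝ) - j| :=
            sum_le_sum_of_subset_of_nonneg
              (erase_subset_erase _ (Ioc_subset_Ioc_left (Nat.zero_le V)))
              fun _ _ _ ↦ by positivity
        _ ≤ 2 * (1 + Real.log N) := sum_one_div_abs_sub_le hj1.2
        _ ≤ _ := by gcongr; linarith
    rw [← add_sum_erase _ _ hj]
    refine (add_le_add hself hoff).trans (le_of_eq ?_)
    field_simp
    ring
  have hsq := norm_sum_mul_sum_sq_le (Ioc V N) (Ioc V N)
    (fun d hd ↦ by rw [mem_Ioc] at hd; omega) hα β (kernel X y N)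
  have hbound : ‖∑ d ∈ Ioc V N, α d * ∑ j ∈ Ioc V N, β j * kernel X y N d j‖ ^ 2 ≤
      (9 * N * ℓ ^ 4 / √X) ^ 2 := by
    refine hsq.trans ?_
    calc _ ≤ 2 * ℓ * (17 * N ^ 2 * ℓ ^ 6 / X * (2 * ℓ)) := by
          gcongr
          refine (sum_le_sum hinner).trans ?_
          rw [← mul_sum]
          gcongr
      _ = 68 * (N ^ 2 * ℓ ^ 8 / X) := by ring
      _ ≤ 81 * (N ^ 2 * ℓ ^ 8 / X) := by gcongr; norm_num
      _ = _ := by rw [div_pow, Real.sq_sqrt hX0.le]; ring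
  exact le_of_sq_le_sq hbound (by positivity)

end Bilinear

/-- Cancellation in `∑ Λ(n) e(X / log n)` over `y < n ≤ N`. -/
theorem norm_sum_vonMangoldt_mul_e_le {X : ℝ} {y N V : ℕ} (hX : 1 ≤ X) (hy : 3 ≤ y)
    (hyN : y ≤ N) (hV : 2 * X ≤ V) (hVy : 2 * X * (V ^ 2 : ℕ) ≤ y) :
    ‖∑ n ∈ Ioc y N, (Λ n : ℂ) * e (X / Real.log n)‖ ≤ 17 * N * Real.log (2 * N) ^ 4 / √X := by
  have hX0 : 0 < X := by linarith
  have hN3 : (3 : ℝ) ≤ N := by exact_mod_cast hy.trans hyN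
  set ℓ := Real.log (2 * N) with hℓ
  have hℓ1 : 1 ≤ ℓ := one_le_log (by linarith)
  have hlogN : Real.log N ≤ ℓ := Real.log_le_log (by linarith) (by linarith)
  have hV1 : 1 ≤ V := by
    have : (0 : ℝ) < V := by linarith
    exact_mod_cast this
  have hVV : V ≤ V ^ 2 := Nat.le_self_pow two_ne_zero V
  have hVy' : V ^ 2 ≤ y := by
    have : ((V ^ 2 : ℕ) : ℝ) ≤ 2 * X * (V ^ 2 : ℕ) :=
      le_mul_of_one_le_left (by positivity) (by linarith)
    exact_mod_cast this.trans hVy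
  have hlog_le : ∀ d, 0 < d → d ≤ N → Real.log d ≤ ℓ := fun d hd hdN ↦
    (Real.log_le_log (by exact_mod_cast hd) (by exact_mod_cast hdN)).trans hlogN
  set F : ℕ → ℂ := fun n ↦ e (X / Real.log n) with hF
  have hsqrt : √X ≤ X := Real.sqrt_le_iff.2 ⟨hX0.le, by nlinarith⟩
  have hsqrt0 : 0 < √X := Real.sqrt_pos.2 hX0
  have h0 : ∀ n ∈ Ioc y N, trunc Λ V n = 0 := by
    intro n hn
    rw [mem_Ioc] at hn
    rw [trunc_apply, if_neg (by omega)]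
  have hsplit : ∑ n ∈ Ioc y N, (Λ n : ℂ) * F n =
      ∑ n ∈ Ioc y N, ((trunc μ V * log) n : ℂ) * F n -
      ∑ n ∈ Ioc y N, ((trunc μ V * trunc Λ V * ζ) n : ℂ) * F n +
      ∑ n ∈ Ioc y N, ((((μ : ArithmeticFunction ℝ) - trunc μ V) * ((Λ - trunc Λ V) * ζ)) n : ℂ)
        * F n := by
    rw [← sum_sub_distrib, ← sum_add_distrib]
    refine sum_congr rfl fun n hn ↦ ?_
    have h := congrArg (fun f : ArithmeticFunction ℝ ↦ f n) (vaughan V)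
    simp only [ArithmeticFunction.add_apply, sub_eq_add_neg _ (trunc μ V * trunc Λ V * ζ),
      ArithmeticFunction.neg_apply, h0 n hn, zero_add] at h
    rw [h]
    push_cast
    ring
  have hI1 : ‖∑ n ∈ Ioc y N, ((trunc μ V * log) n : ℂ) * F n‖ ≤
      1 * (2 * N * ℓ ^ 3 / X) * (2 * ℓ) := by
    rw [sum_Ioc_mul_mul_eq]
    refine norm_sum_mul_le_of_support (D := V ^ 2) zero_le_one (by positivity) hℓ1 hlogN
      (fun d _ ↦ abs_trunc_moebius_le V d) ?_ ?_
    · intro d hd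
      rw [trunc_apply, if_neg (by omega)]
    · intro d hd hdV hdN
      have hd' : (0 : ℝ) < d := by exact_mod_cast hd
      simp only [hF, log_apply, Nat.cast_mul]
      refine (norm_sum_log_mul_e_div_log_le hX0 (hy.trans (lt_mul_div_add_one hd y).le)
        (le_div_add_one hd hdV hVy hX0) (log_mul_div_add_one_le hd hdN)).trans ?_
      have hb := div_add_one_le hd hdN
      have hb' : Real.log (N / d + 1 : ℕ) ≤ ℓ := by
        refine Real.log_le_log (by positivity) (hb.trans (div_le_self (by positivity) ?_))
        exact_mod_cast hd
      calc _ ≤ ℓ * (2 * N / d * ℓ ^ 2 / X) := by gcongr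
        _ = _ := by field_simp
  have hI2 : ‖∑ n ∈ Ioc y N, ((trunc μ V * trunc Λ V * ζ) n : ℂ) * F n‖ ≤
      ℓ * (2 * N * ℓ ^ 2 / X) * (2 * ℓ) := by
    rw [sum_Ioc_mul_mul_eq]
    refine norm_sum_mul_le_of_support (D := V ^ 2) (by linarith) (by positivity) hℓ1 hlogN
      (fun d hd ↦ ?_) (fun d hd ↦ trunc_mul_trunc_eq_zero _ _ hd) ?_
    · rw [mem_Ioc] at hd
      exact (abs_mul_le_log (abs_trunc_moebius_le V) (abs_trunc_vonMangoldt_le V) d).trans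
        (hlog_le d hd.1 hd.2)
    · intro d hd hdV hdN
      have hd' : (0 : ℝ) < d := by exact_mod_cast hd
      have hb := div_add_one_le hd hdN
      have hζ : ∀ m ∈ Ico (y / d + 1) (N / d + 1),
          (((ζ : ArithmeticFunction ℝ) m : ℝ) : ℂ) * F (d * m) = e (X / Real.log (d * m)) := by
        intro m hm
        rw [mem_Ico] at hm
        have hm0 : m ≠ 0 := ((Nat.succ_pos _).trans_le hm.1).ne'
        rw [natCoe_apply, zeta_apply_ne hm0]
        simp [hF]
      rw [sum_congr rfl hζ]
      refine (norm_sum_e_div_log_le hX0 (hy.trans (lt_mul_div_add_one hd y).le)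
        (le_div_add_one hd hdV hVy hX0) (log_mul_div_add_one_le hd hdN)).trans ?_
      calc _ ≤ 2 * N / d * ℓ ^ 2 / X := by gcongr
        _ = _ := by field_simp
  have hII : ‖∑ n ∈ Ioc y N,
      ((((μ : ArithmeticFunction ℝ) - trunc μ V) * ((Λ - trunc Λ V) * ζ)) n : ℂ) * F n‖ ≤
      9 * N * ℓ ^ 4 / √X := by
    set f := (μ : ArithmeticFunction ℝ) - trunc μ V with hf
    set g := (Λ - trunc Λ V) * (ζ : ArithmeticFunction ℝ) with hg
    have hf1 : ∀ d, ‖(f d : ℂ)‖ ≤ 1 := by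
      intro d
      rw [Complex.norm_real, Real.norm_eq_abs, hf, sub_trunc_apply]
      split_ifs
      · simp
      · exact abs_moebius_le d
    have hg1 : ∀ j, 0 < j → j ≤ N → ‖(g j : ℂ)‖ ≤ ℓ := by
      intro j hj hjN
      rw [Complex.norm_real, Real.norm_eq_abs, hg, mul_comm]
      refine (abs_mul_le_log (fun n ↦ ?_) (abs_sub_trunc_vonMangoldt_le V) j).trans
        (hlog_le j hj hjN)
      rw [natCoe_apply, zeta_apply]
      split_ifs <;> simp
    have hf0 : ∀ d, d ≤ V → f d = 0 := fun d hd ↦ by rw [hf, sub_trunc_apply, if_pos hd]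
    have hg0 : ∀ j, j ≤ V → g j = 0 := by
      intro j hj
      rw [hg, coe_mul_zeta_apply]
      refine sum_eq_zero fun i hi ↦ ?_
      rw [sub_trunc_apply, if_pos ((Nat.divisor_le hi).trans hj)]
    refine le_trans (le_of_eq (congrArg _ ?_)) (norm_sum_bilinear_le hX hy hV hyN hf1 hg1)
    rw [sum_Ioc_mul_mul_eq]
    symm
    refine sum_subset_zero_on_sdiff (Ioc_subset_Ioc_left (Nat.zero_le V)) ?_ ?_
    · intro d hd
      rw [mem_sdiff, mem_Ioc, mem_Ioc] at hd
      rw [hf0 d (by omega)]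
      simp
    · intro d hd
      rw [mem_Ioc] at hd
      congr 1
      have hd0 : 0 < d := by omega
      have hker : ∀ j, (g j : ℂ) * kernel X y N d j =
          if y < d * j ∧ d * j ≤ N then (g j : ℂ) * F (d * j) else 0 := by
        intro j
        unfold kernel
        simp only [hF, Nat.cast_mul]
        split_ifs <;> simp
      simp_rw [hker]
      rw [← sum_filter]
      refine sum_subset_zero_on_sdiff ?_ ?_ fun _ _ ↦ rfl
      · intro j hj
        simp only [mem_filter, mem_Ioc, mem_Ico, Nat.succ_le_iff, Nat.lt_succ_iff,
          Nat.div_lt_iff_lt_mul hd0, Nat.le_div_iff_mul_le hd0, mul_comm d] at hj ⊢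
        exact hj.2
      · intro j hj
        simp only [mem_sdiff, mem_filter, mem_Ioc, mem_Ico, Nat.succ_le_iff, Nat.lt_succ_iff,
          Nat.div_lt_iff_lt_mul hd0, Nat.le_div_iff_mul_le hd0, mul_comm d] at hj
        have : j ≤ V := by
          by_contra! hjV
          exact hj.2 ⟨⟨hjV, (Nat.le_mul_of_pos_right j hd0).trans hj.1.2⟩, hj.1⟩
        rw [hg0 j this]
        simp
  rw [hsplit]
  calc _ ≤ 1 * (2 * N * ℓ ^ 3 / X) * (2 * ℓ) + ℓ * (2 * N * ℓ ^ 2 / X) * (2 * ℓ) +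
        9 * N * ℓ ^ 4 / √X :=
        (norm_add_le _ _).trans (add_le_add ((norm_sub_le _ _).trans (add_le_add hI1 hI2)) hII)
    _ = 8 * N * ℓ ^ 4 / X + 9 * N * ℓ ^ 4 / √X := by ring
    _ ≤ 8 * N * ℓ ^ 4 / √X + 9 * N * ℓ ^ 4 / √X := by gcongr
    _ = _ := by ring

/-- The modified Fejér kernel `(cos (2πφ) - c) |∑_{k < H} e (kφ)|²`. -/
def fejer (c : ℝ) (H : ℕ) (φ : ℝ) : ℝ :=
  (Real.cos (2 * Real.pi * φ) - c) * ‖∑ k ∈ range H, e (k * φ)‖ ^ 2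

lemma fejer_eq (c : ℝ) (H : ℕ) (φ : ℝ) : fejer c H φ =
    ∑ j ∈ range H, ∑ k ∈ range H,
      ((e (((j : ℝ) + 1 - k) * φ)).re - c * (e (((j : ℝ) - k) * φ)).re) := by
  have h1 : ((‖∑ k ∈ range H, e (k * φ)‖ ^ 2 : ℝ) : ℂ) =
      ∑ j ∈ range H, ∑ k ∈ range H, e (((j : ℝ) - k) * φ) := by
    push_cast
    rw [← Complex.mul_conj', map_sum, sum_mul_sum]
    simp_rw [← e_sub, ← sub_mul]
  have h2 : fejer c H φ = ((e φ - c) * ((‖∑ k ∈ range H, e (k * φ)‖ ^ 2 : ℝ) : ℂ)).re := by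
    rw [Complex.re_mul_ofReal, Complex.sub_re, re_e, Complex.ofReal_re, fejer]
  rw [h2, h1, mul_sum, Complex.re_sum]
  refine sum_congr rfl fun j _ ↦ ?_
  rw [mul_sum, Complex.re_sum]
  refine sum_congr rfl fun k _ ↦ ?_
  rw [sub_mul, ← e_add, Complex.sub_re, Complex.re_ofReal_mul]
  congr 3
  ring_nf

lemma fejer_le {c : ℝ} (hc : -1 ≤ c) (H : ℕ) (φ : ℝ) : fejer c H φ ≤ 2 * (H : ℝ) ^ 2 := by
  have h1 : ‖∑ k ∈ range H, e (k * φ)‖ ≤ H :=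
    (norm_sum_le _ _).trans (by simp [norm_e])
  have := Real.cos_le_one (2 * Real.pi * φ)
  unfold fejer
  gcongr
  linarith

lemma exists_int_abs_add_lt_of_fejer_pos {δ φ : ℝ} (hδ : 0 < δ) {H : ℕ}
    (h : 0 < fejer (Real.cos (Real.pi * δ)) H φ) : ∃ n : ℤ, |φ + n| < δ / 2 := by
  by_contra! hn
  have h1 := hn (-round φ)
  have h2 := abs_sub_round φ
  push_cast at h1
  rw [← sub_eq_add_neg] at h1
  have h3 : Real.cos (2 * Real.pi * φ) = Real.cos (2 * Real.pi * |φ - round φ|) := by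
    rw [← Real.cos_abs (2 * Real.pi * |φ - round φ|), abs_mul, abs_abs, ← abs_mul, Real.cos_abs,
      mul_sub, mul_comm (2 * Real.pi) (round φ : ℝ), Real.cos_sub_int_mul_two_pi]
  have h4 : Real.cos (2 * Real.pi * |φ - round φ|) ≤ Real.cos (Real.pi * δ) := by
    apply Real.cos_le_cos_of_nonneg_of_le_pi <;> nlinarith [Real.pi_pos]
  refine h.not_ge (mul_nonpos_of_nonpos_of_nonneg ?_ (by positivity))
  rw [h3]
  linarith

open scoped Classical in
/-- A quantitative equidistribution criterion, by means of the Fejér kernel. -/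
lemma sum_sub_le_of_norm_sum_e_le {P : Finset ℕ} {w φ : ℕ → ℝ} {δ E : ℝ} {H : ℕ}
    (hw : ∀ p ∈ P, 0 ≤ w p) (hδ : 0 < δ) (hδ1 : δ ≤ 1) (hH : 1 ≤ H * δ ^ 2) (hE0 : 0 ≤ E)
    (hE : ∀ h : ℕ, 1 ≤ h → h ≤ H → ‖∑ p ∈ P, (w p : ℂ) * e (h * φ p)‖ ≤ E) :
    ∑ p ∈ P, w p - 2 * (H : ℝ) ^ 2 * E ≤
      2 * (H : ℝ) ^ 2 * ∑ p ∈ P with ∃ n : ℤ, |φ p + n| < δ / 2, w p := by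
  set c := Real.cos (Real.pi * δ) with hc
  set Ψ := ∑ p ∈ P, w p with hΨ
  have hΨ0 : 0 ≤ Ψ := sum_nonneg hw
  have hc1 : -1 ≤ c := Real.neg_one_le_cos _
  have hc2 : c ≤ 1 := Real.cos_le_one _
  have hc3 : 2 ≤ H * (1 - c) := by
    have h1 := Real.cos_le_one_sub_mul_cos_sq (x := Real.pi * δ)
      (by rw [abs_of_pos (by positivity)]; nlinarith [Real.pi_pos])
    have h2 : 2 / Real.pi ^ 2 * (Real.pi * δ) ^ 2 = 2 * δ ^ 2 := by
      field_simp
    rw [h2] at h1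
    have : (H : ℝ) * (2 * δ ^ 2) ≤ H * (1 - c) := by gcongr; linarith
    linarith
  have hup : ∑ p ∈ P, w p * fejer c H (φ p) ≤
      2 * (H : ℝ) ^ 2 * ∑ p ∈ P with ∃ n : ℤ, |φ p + n| < δ / 2, w p := by
    rw [sum_filter, mul_sum]
    refine sum_le_sum fun p hp ↦ ?_
    split_ifs with h
    · rw [mul_comm]
      gcongr
      exacts [hw p hp, fejer_le hc1 _ _]
    · rw [mul_zero]
      refine mul_nonpos_of_nonneg_of_nonpos (hw p hp) ?_
      by_contra! h'
      exact h (exists_int_abs_add_lt_of_fejer_pos hδ h')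
  refine le_trans ?_ hup
  let T : ℝ → ℝ := fun h ↦ (∑ p ∈ P, (w p : ℂ) * e (h * φ p)).re
  have hT0 : T 0 = Ψ := by simp [T, e_zero, hΨ]
  have hT : ∀ h : ℤ, h ≠ 0 → |h| ≤ H → |T h| ≤ E := by
    intro h h0 hH'
    refine (Complex.abs_re_le_norm _).trans ?_
    rcases lt_or_gt_of_ne h0 with hneg | hpos
    · obtain ⟨m, rfl⟩ : ∃ m : ℕ, h = -m := ⟨h.natAbs, by omega⟩
      rw [← Complex.norm_conj, map_sum]
      have := hE m (by omega) (by simpa using hH')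
      refine le_of_eq_of_le (congrArg _ (sum_congr rfl fun p _ ↦ ?_)) this
      rw [map_mul, conj_e, Complex.conj_ofReal]
      push_cast
      congr 2
      ring
    · obtain ⟨m, rfl⟩ : ∃ m : ℕ, h = m := ⟨h.natAbs, by omega⟩
      exact_mod_cast hE m (by omega) (by simpa using hH')
  have hswap : ∑ p ∈ P, w p * fejer c H (φ p) =
      ∑ j ∈ range H, ∑ k ∈ range H, (T ((j : ℝ) + 1 - k) - c * T ((j : ℝ) - k)) := by
    simp_rw [fejer_eq, mul_sum]
    rw [sum_comm]
    refine sum_congr rfl fun j _ ↦ ?_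
    rw [sum_comm]
    refine sum_congr rfl fun k _ ↦ ?_
    simp only [T, Complex.re_sum, Complex.re_ofReal_mul, mul_sum, ← sum_sub_distrib]
    exact sum_congr rfl fun p _ ↦ by ring
  rw [hswap]
  have hterm : ∀ j ∈ range H, ∀ k ∈ range H,
      ((if k = j + 1 then Ψ else 0) - (if k = j then c * Ψ else 0)) - 2 * E ≤
      T ((j : ℝ) + 1 - k) - c * T ((j : ℝ) - k) := by
    intro j hj k hk
    rw [mem_range] at hj hk
    have hA : (if k = j + 1 then Ψ else 0) - E ≤ T ((j : ℝ) + 1 - k) := by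
      split_ifs with h
      · subst h
        push_cast
        rw [sub_self, hT0]
        linarith
      · have := hT ((j : ℤ) + 1 - k) (by omega) (by rw [abs_le]; omega)
        push_cast at this
        linarith [neg_abs_le (T ((j : ℝ) + 1 - k))]
    have hB : c * T ((j : ℝ) - k) ≤ (if k = j then c * Ψ else 0) + E := by
      split_ifs with h
      · subst h
        rw [sub_self, hT0]
        linarith
      · have := hT ((j : ℤ) - k) (by omega) (by rw [abs_le]; omega)
        push_cast at this
        calc _ ≤ |c * T ((j : ℝ) - k)| := le_abs_self _
          _ = |c| * |T ((j : ℝ) - k)| := abs_mul _ _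
          _ ≤ 1 * E := by
            gcongr
            exact abs_le.2 ⟨hc1, hc2⟩
          _ = 0 + E := by ring
    linarith
  refine le_trans ?_ (sum_le_sum fun j hj ↦ sum_le_sum fun k hk ↦ hterm j hj k hk)
  have hdiag : ∑ j ∈ range H, ∑ k ∈ range H, (if k = j then c * Ψ else 0) = H * (c * Ψ) := by
    rw [sum_congr rfl fun j hj ↦ by rw [sum_ite_eq' (range H) j, if_pos hj]]
    simp
  have hshift : (H - 1) * Ψ ≤ ∑ j ∈ range H, ∑ k ∈ range H, (if k = j + 1 then Ψ else 0) := by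
    simp_rw [sum_ite_eq' (range H), mem_range]
    rcases H with _ | m
    · simpa using hΨ0
    · rw [sum_range_succ, sum_congr rfl fun j hj ↦ if_pos (by simpa using hj)]
      simp
  simp_rw [sum_sub_distrib]
  rw [hdiag]
  simp only [sum_const, card_range, nsmul_eq_mul]
  nlinarith

lemma norm_sum_log_prime_mul_e_le {X : ℝ} {y N V : ℕ} (hX : 1 ≤ X) (hy : 3 ≤ y)
    (hyN : y ≤ N) (hV : 2 * X ≤ V) (hVy : 2 * X * (V ^ 2 : ℕ) ≤ y) :
    ‖∑ p ∈ Ioc y N with p.Prime, (Real.log p : ℂ) * e (X / Real.log p)‖ ≤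
      17 * N * Real.log (2 * N) ^ 4 / √X + 2 * √N * Real.log N := by
  have hsplit := sum_filter_add_sum_filter_not (Ioc y N) Nat.Prime
    fun n ↦ (Λ n : ℂ) * e (X / Real.log n)
  have h1 : ∑ p ∈ Ioc y N with p.Prime, (Real.log p : ℂ) * e (X / Real.log p) =
      ∑ p ∈ Ioc y N with p.Prime, (Λ p : ℂ) * e (X / Real.log p) :=
    sum_congr rfl fun p hp ↦ by rw [vonMangoldt_apply_prime (mem_filter.1 hp).2]
  have h2 : ‖∑ p ∈ Ioc y N with ¬ p.Prime, (Λ p : ℂ) * e (X / Real.log p)‖ ≤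
      2 * √N * Real.log N := by
    refine (norm_sum_le _ _).trans (le_trans ?_
      (Chebyshev.psi_sub_theta_le (x := N) (by exact_mod_cast (by omega : 1 ≤ N))))
    rw [Chebyshev.psi_sub_theta_eq_sum_not_prime, Nat.floor_natCast]
    calc _ = ∑ p ∈ Ioc y N with ¬ p.Prime, Λ p := by
          refine sum_congr rfl fun p _ ↦ ?_
          rw [norm_mul, norm_e, mul_one, Complex.norm_real, Real.norm_of_nonneg vonMangoldt_nonneg]
      _ ≤ _ := sum_le_sum_of_subset_of_nonneg
          (filter_subset_filter _ (Ioc_subset_Ioc_left (Nat.zero_le y)))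
          fun _ _ _ ↦ vonMangoldt_nonneg
  rw [h1, eq_sub_of_add_eq hsplit]
  exact (norm_sub_le _ _).trans (add_le_add (norm_sum_vonMangoldt_mul_e_le hX hy hyN hV hVy) h2)

/-- The prime powers in `(Q, 2Q]` with base prime at most `z`. -/
def primePowers (Q z : ℝ) : Set ℕ :=
  {q : ℕ | Q < (q : ℝ) ∧ (q : ℝ) ≤ 2 * Q ∧
    ∃ p N : ℕ, p.Prime ∧ 1 ≤ N ∧ q = p ^ N ∧ (p : ℝ) ≤ z}

lemma finite_primePowers (Q z : ℝ) : (primePowers Q z).Finite :=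
  (Set.finite_Iic ⌊2 * Q⌋₊).subset fun _ hq ↦ Nat.le_floor hq.2.1

lemma card_le_ncard_primePowers {Q z : ℝ} (G : Finset ℕ) (hG : ∀ p ∈ G, p.Prime)
    (hz : ∀ p ∈ G, (p : ℝ) ≤ z)
    (h : ∀ p ∈ G, ∃ m : ℕ, 1 ≤ m ∧ Q < (p : ℝ) ^ m ∧ (p : ℝ) ^ m ≤ 2 * Q) :
    #G ≤ (primePowers Q z).ncard := by
  choose! m hm1 hm2 hm3 using h
  rw [← Set.ncard_coe_finset]
  refine Set.ncard_le_ncard_of_injOn (fun p ↦ p ^ m p) (fun p hp ↦ ?_) (fun p hp q hq hpq ↦ ?_)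
    (finite_primePowers Q z)
  · exact ⟨by exact_mod_cast hm2 p hp, by exact_mod_cast hm3 p hp, p, m p, hG p hp, hm1 p hp, rfl,
      hz p hp⟩
  · have h0 : m p ≠ 0 := Nat.one_le_iff_ne_zero.1 (hm1 p hp)
    exact (Nat.prime_dvd_prime_iff_eq (hG p hp) (hG q hq)).1
      ((hG p hp).dvd_of_dvd_pow ((dvd_pow_self p h0).trans hpq.dvd))

lemma exists_pow_mem_of_abs_add_lt {Q δ u : ℝ} {p : ℕ} (hp : 2 ≤ p) (hQ : 1 < Q)
    (hpu : Real.log p ≤ u) (hδ : δ * u = Real.log 2) (hδ0 : 0 < δ) {n : ℤ}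
    (h : |-(Real.log Q / Real.log p + δ / 2) + n| < δ / 2) :
    ∃ m : ℕ, 1 ≤ m ∧ Q < (p : ℝ) ^ m ∧ (p : ℝ) ^ m ≤ 2 * Q := by
  have hp1 : (1 : ℝ) < p := by exact_mod_cast (by omega : 1 < p)
  have hlog : 0 < Real.log p := Real.log_pos hp1
  have hlogQ : 0 < Real.log Q := Real.log_pos hQ
  rw [abs_lt] at h
  have h1 : Real.log Q / Real.log p < n := by linarith [h.1]
  have h2 : (n : ℝ) < Real.log Q / Real.log p + δ := by linarith [h.2]
  have hn : 0 < n := by exact_mod_cast (div_pos hlogQ hlog).trans h1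
  obtain ⟨m, rfl⟩ : ∃ m : ℕ, n = m := ⟨n.natAbs, by omega⟩
  rw [Int.cast_natCast] at h1 h2
  rw [div_lt_iff₀ hlog] at h1
  have h3 : m * Real.log p ≤ Real.log Q + Real.log 2 := by
    have := mul_le_mul_of_nonneg_right h2.le hlog.le
    rw [add_mul, div_mul_cancel₀ _ hlog.ne'] at this
    nlinarith
  have hpm : 0 < (p : ℝ) ^ m := by positivity
  refine ⟨m, by exact_mod_cast hn, ?_, ?_⟩
  · rwa [← Real.log_lt_log_iff (by linarith) hpm, Real.log_pow]
  · rw [← Real.log_le_log_iff hpm (by linarith), Real.log_pow,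
      Real.log_mul (by norm_num) (by linarith)]
    linarith

lemma theta_sub_theta_eq {y N : ℕ} (hyN : y ≤ N) :
    Chebyshev.theta N - Chebyshev.theta y = ∑ p ∈ Ioc y N with p.Prime, Real.log p := by
  rw [Chebyshev.theta, Chebyshev.theta, Nat.floor_natCast, Nat.floor_natCast, sub_eq_iff_eq_add',
    sum_filter, sum_filter, sum_filter]
  exact (sum_Ioc_consecutive _ (Nat.zero_le y) hyN).symm

lemma theta_sub_theta_le_ncard {Q : ℝ} {y H V : ℕ} (hy : 3 ≤ y) (hQ1 : 1 < Q)
    (hQ : 1 ≤ Real.log Q)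
    (hH : 1 ≤ H * (Real.log 2 / Real.log (4 * y)) ^ 2) (hV : 2 * (H * Real.log Q) ≤ V)
    (hVy : 2 * (H * Real.log Q) * (V ^ 2 : ℕ) ≤ y) :
    Chebyshev.theta (4 * y : ℕ) - Chebyshev.theta y - 2 * (H : ℝ) ^ 2 *
      (68 * y * Real.log (8 * y) ^ 4 / √(Real.log Q) + 4 * √y * Real.log (4 * y)) ≤
      2 * (H : ℝ) ^ 2 * (Real.log (4 * y) * (primePowers Q (4 * y)).ncard) := by
  have hy' : (3 : ℝ) ≤ y := by exact_mod_cast hy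
  have hu : 1 ≤ Real.log (4 * y) := one_le_log (by linarith)
  have hl2 : 0 < Real.log 2 := Real.log_pos (by norm_num)
  set δ := Real.log 2 / Real.log (4 * y) with hδ
  have hδ0 : 0 < δ := by positivity
  have hδ1 : δ ≤ 1 := by
    rw [hδ, div_le_one (by linarith)]
    exact Real.log_le_log (by norm_num) (by linarith)
  set E := 68 * y * Real.log (8 * y) ^ 4 / √(Real.log Q) + 4 * √y * Real.log (4 * y) with hE
  have hE0 : 0 ≤ E := by
    have : 0 ≤ Real.log (8 * y) ^ 4 := by positivity
    positivity
  have hlog : ∀ p ∈ (Ioc y (4 * y)).filter Nat.Prime, 0 ≤ Real.log p :=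
    fun p _ ↦ Real.log_natCast_nonneg p
  classical
  have key := sum_sub_le_of_norm_sum_e_le (φ := fun p ↦ -(Real.log Q / Real.log p + δ / 2))
    hlog hδ0 hδ1 hH hE0 fun h h1 hhH ↦ by
      have hh : (1 : ℝ) ≤ h := by exact_mod_cast h1
      have hhH' : (h : ℝ) ≤ H := by exact_mod_cast hhH
      have hX : 1 ≤ h * Real.log Q := one_le_mul_of_one_le_of_one_le hh hQ
      have hXH : h * Real.log Q ≤ H * Real.log Q := by gcongr
      have hb := norm_sum_log_prime_mul_e_le (N := 4 * y) hX hy (by omega)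
        (le_trans (by gcongr) hV) (le_trans (by gcongr) hVy)
      calc _ = ‖e (-(h * (δ / 2))) * conj (∑ p ∈ Ioc y (4 * y) with p.Prime,
            (Real.log p : ℂ) * e (h * Real.log Q / Real.log p))‖ := by
            rw [map_sum, mul_sum]
            refine congrArg _ (sum_congr rfl fun p _ ↦ ?_)
            rw [map_mul, conj_e, Complex.conj_ofReal, mul_left_comm, ← e_add]
            congr 2
            ring
        _ = ‖∑ p ∈ Ioc y (4 * y) with p.Prime,
            (Real.log p : ℂ) * e (h * Real.log Q / Real.log p)‖ := by
            rw [norm_mul, norm_e, one_mul, Complex.norm_conj]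
        _ ≤ _ := hb
        _ ≤ 68 * y * Real.log (8 * y) ^ 4 / √(Real.log Q) + 4 * √y * Real.log (4 * y) := by
            have h4 : √(4 * y : ℝ) = 2 * √y := by
              rw [Real.sqrt_mul (by norm_num), show (4 : ℝ) = 2 ^ 2 by norm_num,
                Real.sqrt_sq (by norm_num)]
            have h8 : (2 : ℝ) * (4 * y) = 8 * y := by ring
            push_cast
            rw [h4, h8]
            refine add_le_add ?_ (le_of_eq (by ring))
            calc _ = 68 * y * Real.log (8 * y) ^ 4 / √(h * Real.log Q) := by ring
              _ ≤ _ := by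
                gcongr
                exact le_mul_of_one_le_left (by linarith) hh
  rw [theta_sub_theta_eq (by omega)]
  refine key.trans ?_
  gcongr
  set G := ((Ioc y (4 * y)).filter Nat.Prime).filter fun p : ℕ ↦
    ∃ n : ℤ, |-(Real.log Q / Real.log p + δ / 2) + n| < δ / 2 with hG
  have hmem : ∀ p : ℕ, p ∈ G → (y < p ∧ p ≤ 4 * y) ∧ p.Prime ∧
      ∃ n : ℤ, |-(Real.log Q / Real.log p + δ / 2) + n| < δ / 2 := fun p hp ↦ by
    simpa only [hG, mem_filter, mem_Ioc, and_assoc] using hp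
  have hle : ∀ p ∈ G, (p : ℝ) ≤ 4 * y := fun p hp ↦ by exact_mod_cast (hmem p hp).1.2
  have hlogle : ∀ p ∈ G, Real.log p ≤ Real.log (4 * y) := fun p hp ↦
    Real.log_le_log (by exact_mod_cast (hmem p hp).2.1.pos) (hle p hp)
  calc ∑ p ∈ G, Real.log p ≤ #G • Real.log (4 * y) := sum_le_card_nsmul _ _ _ hlogle
    _ = Real.log (4 * y) * #G := by rw [nsmul_eq_mul, mul_comm]
    _ ≤ _ := by
      gcongr
      refine card_le_ncard_primePowers G (fun p hp ↦ (hmem p hp).2.1) hle fun p hp ↦ ?_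
      obtain ⟨n, hn⟩ := (hmem p hp).2.2
      exact exists_pow_mem_of_abs_add_lt (hmem p hp).2.1.two_le hQ1 (hlogle p hp)
        (div_mul_cancel₀ _ (by linarith)) hδ0 hn

lemma le_theta_sub_theta {y : ℕ} (hy : 3 ≤ y) (h : 50 * Real.log (8 * y) ≤ √y) :
    (y : ℝ) ≤ Chebyshev.theta (4 * y : ℕ) - Chebyshev.theta y := by
  have hy' : (3 : ℝ) ≤ y := by exact_mod_cast hy
  have h1 := Chebyshev.theta_ge (4 * y)
  have h2 := Chebyshev.theta_le_log4_mul_x (x := y) (by positivity)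
  have h4 : √(4 * y : ℝ) = 2 * √y := by
    rw [Real.sqrt_mul (by norm_num), show (4 : ℝ) = 2 ^ 2 by norm_num, Real.sqrt_sq (by norm_num)]
  have h5 : Real.log 4 = 2 * Real.log 2 := by
    rw [show (4 : ℝ) = 2 ^ 2 by norm_num, Real.log_pow]
    norm_num
  have h6 : Real.log (4 * y + 1) ≤ Real.log (8 * y) := Real.log_le_log (by positivity) (by linarith)
  have h7 : Real.log (4 * y) ≤ Real.log (8 * y) := Real.log_le_log (by positivity) (by linarith)
  have h8 : 1 ≤ Real.log (8 * y) := one_le_log (by linarith)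
  push_cast at h1 ⊢
  rw [h4] at h1
  have h9 : √y * √y = (y : ℝ) := Real.mul_self_sqrt (by positivity)
  have h10 : 2 * (2 * √y) * Real.log (4 * y) ≤ 2 * (2 * √y) * Real.log (8 * y) := by gcongr
  have h11 : √y * (50 * Real.log (8 * y)) ≤ √y * √y := by gcongr
  have h12 : 1 ≤ √(y : ℝ) := by linarith
  have h13 : Real.log (8 * y) ≤ √y * Real.log (8 * y) := le_mul_of_one_le_left (by linarith) h12
  have h14 : (y : ℝ) * 0.69 ≤ y * Real.log 2 := by
    gcongr
    linarith [Real.log_two_gt_d9]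
  rw [h5] at h2
  linarith

lemma le_ncard_primePowers {Q L M : ℝ} {y : ℕ} (hM : 1 ≤ M) (hQ1 : 1 < Q)
    (hyM : Real.log (8 * y) ≤ M)
    (hQL : Real.log Q ≤ L) (hQ : 10 ^ 8 * M ^ 16 ≤ Real.log Q) (hy : 10 ^ 8 * M ^ 6 * L ^ 3 ≤ y) :
    (y : ℝ) ≤ 256 * M ^ 5 * (primePowers Q (4 * y)).ncard := by
  have hM16 : 1 ≤ M ^ 16 := one_le_pow₀ hM
  have hM6 : 1 ≤ M ^ 6 := one_le_pow₀ hM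
  have hQ2 : 10 ^ 8 ≤ Real.log Q := by linarith
  have hL1 : 1 ≤ L := by linarith
  have hyL : 10 ^ 8 * M ^ 16 ≤ y := by
    calc _ ≤ L := by linarith
      _ ≤ L ^ 3 := le_self_pow₀ hL1 (by norm_num)
      _ ≤ 10 ^ 8 * M ^ 6 * L ^ 3 := le_mul_of_one_le_left (by positivity) (by linarith)
      _ ≤ y := hy
  have hy3' : (3 : ℝ) ≤ y := by linarith
  have hy3 : 3 ≤ y := by exact_mod_cast hy3'
  have hsy : 512 * M ^ 5 ≤ √y := by
    refine Real.le_sqrt_of_sq_le (le_trans ?_ hyL)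
    calc _ = 262144 * M ^ 10 := by ring
      _ ≤ 10 ^ 8 * M ^ 16 := by
        gcongr ?_ * ?_
        · norm_num
        · exact pow_le_pow_right₀ hM (by norm_num)
  have hsQ : 8704 * M ^ 8 ≤ √(Real.log Q) := by
    refine Real.le_sqrt_of_sq_le (le_trans ?_ hQ)
    calc _ = 75759616 * M ^ 16 := by ring
      _ ≤ 10 ^ 8 * M ^ 16 := by
        gcongr
        norm_num
  have hu : 1 ≤ Real.log (4 * y) := one_le_log (by linarith)
  have huM : Real.log (4 * y) ≤ M :=
    (Real.log_le_log (by positivity) (by linarith)).trans hyM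
  have hu8 : 1 ≤ Real.log (8 * y) := one_le_log (by linarith)
  have hl2 : (1 / 2 : ℝ) < Real.log 2 := by linarith [Real.log_two_gt_d9]
  have hMM : M ≤ M ^ 5 := le_self_pow₀ hM (by norm_num)
  have hu2 : Real.log (4 * y) / Real.log 2 ≤ 2 * M := by
    rw [div_le_iff₀ (by linarith)]
    nlinarith
  obtain ⟨H, hH1, hH2⟩ : ∃ H : ℕ, 1 ≤ H * (Real.log 2 / Real.log (4 * y)) ^ 2 ∧
      (H : ℝ) ≤ 5 * M ^ 2 := by
    refine ⟨⌈(Real.log (4 * y) / Real.log 2) ^ 2⌉₊, ?_, ?_⟩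
    · calc 1 = (Real.log (4 * y) / Real.log 2) ^ 2 * (Real.log 2 / Real.log (4 * y)) ^ 2 := by
            rw [← mul_pow, div_mul_div_cancel₀ (by linarith), div_self (by linarith), one_pow]
        _ ≤ _ := by
          gcongr
          exact Nat.le_ceil _
    · refine (Nat.ceil_lt_add_one (by positivity)).le.trans ?_
      have : (Real.log (4 * y) / Real.log 2) ^ 2 ≤ (2 * M) ^ 2 := by gcongr
      nlinarith
  have hVle : (⌈10 * M ^ 2 * L⌉₊ : ℝ) ≤ 11 * M ^ 2 * L := by
    refine (Nat.ceil_lt_add_one (by positivity)).le.trans ?_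
    have : 1 ≤ M ^ 2 * L := one_le_mul_of_one_le_of_one_le (one_le_pow₀ hM) hL1
    linarith
  have hHQ : 2 * (H * Real.log Q) ≤ 10 * M ^ 2 * L := by
    calc _ ≤ 2 * (5 * M ^ 2 * L) := by gcongr
      _ = _ := by ring
  have key := theta_sub_theta_le_ncard hy3 hQ1 (by linarith) hH1 (hHQ.trans (Nat.le_ceil _)) (by
    push_cast
    calc _ ≤ (10 * M ^ 2 * L) * (11 * M ^ 2 * L) ^ 2 := by gcongr
      _ = 1210 * M ^ 6 * L ^ 3 := by ring
      _ ≤ 10 ^ 8 * M ^ 6 * L ^ 3 := by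
        gcongr
        norm_num
      _ ≤ y := hy)
  have htheta := le_theta_sub_theta hy3 (by linarith)
  have hE : 2 * (H : ℝ) ^ 2 *
      (68 * y * Real.log (8 * y) ^ 4 / √(Real.log Q) + 4 * √y * Real.log (4 * y)) ≤
      25 / 32 * y := by
    calc _ ≤ 2 * (5 * M ^ 2) ^ 2 * (68 * y * M ^ 4 / (8704 * M ^ 8) + 4 * √y * M) := by gcongr
      _ = 25 / 64 * y + 25 / 64 * (√y * (512 * M ^ 5)) := by
        field_simp
        ring
      _ ≤ 25 / 64 * y + 25 / 64 * (√y * √y) := by gcongr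
      _ = _ := by
        rw [Real.mul_self_sqrt (by positivity)]
        ring
  have hmain : 2 * (H : ℝ) ^ 2 * (Real.log (4 * y) * (primePowers Q (4 * y)).ncard) ≤
      50 * (M ^ 5 * (primePowers Q (4 * y)).ncard) := by
    calc _ ≤ 2 * (5 * M ^ 2) ^ 2 * (M * (primePowers Q (4 * y)).ncard) := by gcongr
      _ = _ := by ring
  have h0 : 0 ≤ M ^ 5 * (primePowers Q (4 * y)).ncard := by positivity
  linarith

lemma eventually_mul_log_pow_le (K a : ℝ) (n : ℕ) :
    ∀ᶠ L : ℝ in Filter.atTop, K * (a * Real.log L) ^ n ≤ L := by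
  have h := (Real.isLittleO_pow_log_id_atTop (n := n)).const_mul_left (K * a ^ n)
  filter_upwards [h.bound one_pos, Filter.eventually_ge_atTop 0] with L hL h0
  rw [one_mul, id, Real.norm_of_nonneg h0] at hL
  rw [mul_pow, ← mul_assoc]
  exact (Real.le_norm_self _).trans hL

lemma rpow_sub_one_le_ncard_primePowers {C Q L M : ℝ} (hC : 6 ≤ C)
    (hM : M = (C + 1) * Real.log L) (hM1 : 1 ≤ M) (hL : 2 ≤ L) (hL1 : 10 ^ 9 * M ^ 6 ≤ L)
    (hQ1 : 1 < Q) (hQ : 10 ^ 8 * M ^ 16 ≤ Real.log Q) (hQL : Real.log Q ≤ L) :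
    L ^ (C - 1) ≤ (primePowers Q (L ^ C)).ncard := by
  have hL0 : 0 < L := by linarith
  have hLC : L ^ 6 ≤ L ^ C := by
    rw [← Real.rpow_natCast]
    exact Real.rpow_le_rpow_of_exponent_le (by linarith) (by simpa using hC)
  have hL2 : (2 : ℝ) ^ 2 ≤ L ^ 2 := by gcongr
  have hL4 : 8 * (10 ^ 8 * M ^ 6 * L ^ 3) ≤ L ^ 6 := by
    calc _ = 8 * (10 ^ 8 * M ^ 6) * L ^ 3 := by ring
      _ ≤ L * L ^ 3 := by
        gcongr
        linarith
      _ ≤ L * L ^ 3 * L ^ 2 := le_mul_of_one_le_right (by positivity) (by linarith)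
      _ = L ^ 6 := by ring
  have hML : (1 : ℝ) ≤ M ^ 6 * L ^ 3 :=
    one_le_mul_of_one_le_of_one_le (one_le_pow₀ hM1) (one_le_pow₀ (by linarith))
  set y := ⌊L ^ C / 4⌋₊ with hy
  have hy1 : (y : ℝ) ≤ L ^ C / 4 := Nat.floor_le (by positivity)
  have hy2 : L ^ C / 8 ≤ y := by
    have := (Nat.lt_floor_add_one (L ^ C / 4)).le
    linarith
  have hy0 : (0 : ℝ) < y := by linarith
  have hyM : Real.log (8 * y) ≤ M := by
    calc _ ≤ Real.log (L ^ (C + 1)) := by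
          refine Real.log_le_log (by positivity) ?_
          rw [Real.rpow_add_one hL0.ne']
          nlinarith
      _ = M := by rw [Real.log_rpow hL0, hM]
  have key := le_ncard_primePowers hM1 hQ1 hyM hQL hQ (by linarith)
  have hmono : ((primePowers Q (4 * y)).ncard : ℝ) ≤ (primePowers Q (L ^ C)).ncard := by
    refine Nat.cast_le.2 (Set.ncard_le_ncard ?_ (finite_primePowers _ _))
    rintro q ⟨h1, h2, p, N, hp, hN, hq, hpy⟩
    exact ⟨h1, h2, p, N, hp, hN, hq, by linarith⟩
  have hfin : L ^ (C - 1) * (2048 * M ^ 5) ≤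
      (primePowers Q (L ^ C)).ncard * (2048 * M ^ 5) := by
    calc _ ≤ L ^ (C - 1) * L := by
          gcongr
          refine le_trans ?_ hL1
          gcongr ?_ * ?_
          · norm_num
          · exact pow_le_pow_right₀ hM1 (by norm_num)
      _ = L ^ C := by rw [← Real.rpow_add_one hL0.ne', sub_add_cancel]
      _ ≤ 8 * (256 * M ^ 5 * (primePowers Q (4 * y)).ncard) := by linarith
      _ ≤ 8 * (256 * M ^ 5 * (primePowers Q (L ^ C)).ncard) := by gcongr
      _ = _ := by ring
  exact le_of_mul_le_mul_right hfin (by positivity)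

end PrimePowers

end

/-- Fix `C ≥ 6` and `ε > 0`. For `x^ε ≤ Q ≤ x` and `x` sufficiently large
(depending on `C`, `ε`), the number `S(Q)` of prime powers `p^N ∈ (Q, 2Q]` with
`p ≤ (log x)^C` satisfies `S(Q) ≫ (log x)^(C-1)`. -/
theorem prime_powers_in_dyadic_interval (C : ℝ) (hC : 6 ≤ C) (ε : ℝ) (hε : 0 < ε) :
    ∃ c : ℝ, 0 < c ∧ ∃ x₀ : ℝ, ∀ x : ℝ, x₀ ≤ x →
      ∀ Q : ℝ, x ^ ε ≤ Q → Q ≤ x →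
        c * Real.log x ^ (C - 1) ≤
          ({q : ℕ | Q < (q : ℝ) ∧ (q : ℝ) ≤ 2 * Q ∧
            ∃ p N : ℕ, p.Prime ∧ 1 ≤ N ∧ q = p ^ N ∧ (p : ℝ) ≤ Real.log x ^ C}.ncard : ℝ) := by
  have hev : ∀ᶠ x : ℝ in Filter.atTop, ∀ Q : ℝ, x ^ ε ≤ Q → Q ≤ x →
      Real.log x ^ (C - 1) ≤ (PrimePowers.primePowers Q (Real.log x ^ C)).ncard := by
    filter_upwards [Real.tendsto_log_atTop.eventually
        (PrimePowers.eventually_mul_log_pow_le (10 ^ 9) (C + 1) 6),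
      Real.tendsto_log_atTop.eventually
        (PrimePowers.eventually_mul_log_pow_le (10 ^ 8 / ε) (C + 1) 16),
      Real.tendsto_log_atTop.eventually_ge_atTop 3, Filter.eventually_gt_atTop 1]
      with x h1 h2 h3 h4 Q hQ1 hQ2
    have hlog : 1 ≤ Real.log (Real.log x) := PrimePowers.one_le_log h3
    have hM : 1 ≤ (C + 1) * Real.log (Real.log x) :=
      one_le_mul_of_one_le_of_one_le (by linarith) hlog
    have hQ : 1 < Q := (Real.one_lt_rpow h4 hε).trans_le hQ1
    refine PrimePowers.rpow_sub_one_le_ncard_primePowers hC rfl hM (by linarith) h1 hQ ?_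
      (Real.log_le_log (by linarith) hQ2)
    calc _ ≤ Real.log x * ε := by
          rw [div_mul_eq_mul_div, div_le_iff₀ hε] at h2
          exact h2
      _ = Real.log (x ^ ε) := by rw [Real.log_rpow (by linarith), mul_comm]
      _ ≤ Real.log Q := Real.log_le_log (by positivity) hQ1
  obtain ⟨x₀, hx₀⟩ := Filter.eventually_atTop.1 hev
  refine ⟨1, one_pos, x₀, fun x hx Q hQ1 hQ2 ↦ ?_⟩
  rw [one_mul]
  exact hx₀ x hx Q hQ1 hQ2
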